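/- arXiv:2103.03355 — 4 statements merged into one kernel-verified Lean document; each statement's English description precedes it below -/
import Mathlib

section
/- Let r and t be real numbers with r > 0. Then ∫_{-∞}^{∞} log(r² − 2 r y cos t + y²) / (y² + 1) dy = π · log( r² + 2 r |sin t| + 1 ), where log denotes the real natural logarithm and the integral is a real improper integral over the real line. -/
open MeasureTheory Real

lemma aux_avg (C : ℝ) (w : ℂ) (hw : ‖w‖ ≤ 1) :
    ∫ φ in (-(π/2))..(π/2), (fun z : ℂ => C + 2 * Real.log ‖z - w‖ - 2 * Real.log ‖z - (-1)‖)
      (circleMap 0 1 (2 * φ)) = π * C := by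
  set f : ℂ → ℝ := (fun z : ℂ => C + 2 * Real.log ‖z - w‖ - 2 * Real.log ‖z - (-1)‖) with hf
  have i1 : CircleIntegrable (fun z : ℂ => Real.log ‖z - w‖) 0 1 :=
    circleIntegrable_log_norm_sub_const 1
  have i2 : CircleIntegrable (fun z : ℂ => Real.log ‖z - (-1)‖) 0 1 :=
    circleIntegrable_log_norm_sub_const 1
  have a1 : circleAverage (fun z : ℂ => Real.log ‖z - w‖) 0 1 = 0 := by
    rw [circleAverage_log_norm_sub_const_of_mem_closedBall (by simpa using hw)]; simp
  have a2 : circleAverage (fun z : ℂ => Real.log ‖z - (-1)‖) 0 1 = 0 := by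
    rw [circleAverage_log_norm_sub_const_of_mem_closedBall (by simp)]; simp
  have key : ∫ θ in (0:ℝ)..(2*π), f (circleMap 0 1 θ) = 2 * π * C := by
    unfold circleAverage at a1 a2
    have hpi := Real.pi_pos.ne'
    simp only [smul_eq_mul, mul_eq_zero, inv_eq_zero, OfNat.ofNat_ne_zero, hpi, or_false, false_or]
      at a1 a2
    simp only [hf]
    unfold CircleIntegrable at i1 i2
    rw [intervalIntegral.integral_sub, intervalIntegral.integral_add,
      intervalIntegral.integral_const_mul, intervalIntegral.integral_const_mul, a1, a2]
    · simp
    · simp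
    · exact i1.const_mul 2
    · exact (intervalIntegrable_const).add (i1.const_mul 2)
    · exact i2.const_mul 2
  have hper : Function.Periodic (fun θ => f (circleMap 0 1 θ)) (2*π) :=
    (periodic_circleMap 0 1).comp f
  have h2 := hper.intervalIntegral_add_eq 0 (-π)
  rw [intervalIntegral.integral_comp_mul_left (fun θ => f (circleMap 0 1 θ)) two_ne_zero]
  rw [show 2 * -(π/2) = -π by ring, show 2 * (π/2) = -π + 2 * π by ring, ← h2, zero_add, key]
  simp only [smul_eq_mul]; ring

lemma aux_pt (a b φ : ℝ) (hb : 0 ≤ b) (h1 : -(π/2) < φ) (h2 : φ < π/2) (h3 : tan φ ≠ a) :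
    Real.log ((tan φ - a)^2 + b^2) = (fun z : ℂ => Real.log (a^2 + (b+1)^2) +
      2 * Real.log ‖z - (Complex.I - ⟨a, b⟩)/(Complex.I + ⟨a,b⟩)‖ - 2 * Real.log ‖z - (-1)‖)
      (circleMap 0 1 (2 * φ)) := by
  have hc : 0 < cos φ := cos_pos_of_mem_Ioo ⟨h1, h2⟩
  have hP : 0 < a^2 + (b+1)^2 := by positivity
  have hQ : 0 < (tan φ - a)^2 + b^2 := by
    have := sub_ne_zero.mpr h3
    positivity
  have hz : circleMap 0 1 (2*φ) = ⟨cos φ ^2 - sin φ ^2, 2 * sin φ * cos φ⟩ := by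
    rw [circleMap_zero]
    apply Complex.ext
    · simp [Complex.exp_re, cos_two_mul']
    · simp [Complex.exp_im, sin_two_mul]
  have hne : (Complex.I + ⟨a,b⟩ : ℂ) ≠ 0 := by
    intro h
    have := congrArg Complex.im h
    simp at this; linarith
  have hsc := sin_sq_add_cos_sq φ
  have lg : ∀ z : ℂ, 2 * Real.log ‖z‖ = Real.log (Complex.normSq z) := by
    intro z; rw [Complex.normSq_eq_norm_sq, Real.log_pow]; simp
  have e1 : Complex.normSq (circleMap 0 1 (2*φ) - (-1)) = 4 * cos φ ^2 := by
    rw [hz, Complex.normSq_apply]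
    simp
    have : sin φ ^2 = 1 - cos φ ^2 := by linarith
    linear_combination (cos φ ^2 - 1 + sin φ ^2 + 2 + 2 * (cos φ ^2 - 1) - 2 * cos φ ^ 2) * hsc
  have e2 : Complex.normSq (circleMap 0 1 (2*φ) - (Complex.I - ⟨a, b⟩)/(Complex.I + ⟨a,b⟩)) =
      4 * cos φ ^2 * ((tan φ - a)^2 + b^2) / (a^2+(b+1)^2) := by
    have : circleMap 0 1 (2*φ) - (Complex.I - ⟨a, b⟩)/(Complex.I + ⟨a,b⟩) =
      (circleMap 0 1 (2*φ) * (Complex.I + ⟨a,b⟩) - (Complex.I - ⟨a, b⟩))/(Complex.I + ⟨a,b⟩) := by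
      field_simp
    rw [this, Complex.normSq_div]
    have d : Complex.normSq (Complex.I + ⟨a,b⟩) = a^2+(b+1)^2 := by
      rw [Complex.normSq_apply]; simp; ring
    rw [d]
    congr 1
    have : circleMap 0 1 (2*φ) * (Complex.I + ⟨a,b⟩) - (Complex.I - ⟨a, b⟩) =
      (⟨cos φ, sin φ⟩ : ℂ) * ⟨2 * (a * cos φ - sin φ), 2 * b * cos φ⟩ := by
      rw [hz]
      apply Complex.ext
      · simp
        have : sin φ ^2 = 1 - cos φ ^2 := by linarith
        linear_combination (-a) * hsc
      · simp
        linear_combination (1 - b) * hsc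
    rw [this, Complex.normSq_mul, tan_eq_sin_div_cos]
    simp only [Complex.normSq_apply]
    rw [show cos φ * cos φ + sin φ * sin φ = 1 by linarith]
    field_simp
    ring
  simp only
  rw [lg, lg, e1, e2, Real.log_div (by positivity) hP.ne', Real.log_mul (by positivity) hQ.ne']
  ring

theorem gradshteyn_4_296_2_real (r t : ℝ) (hr : 0 < r) :
    ∫ y : ℝ, Real.log (r ^ 2 - 2 * r * y * Real.cos t + y ^ 2) / (y ^ 2 + 1) =
      π * Real.log (r ^ 2 + 2 * r * |Real.sin t| + 1) := by
  set a := r * cos t with ha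
  set b := r * |sin t| with hb
  have hb0 : 0 ≤ b := by positivity
  have hab : a^2 + b^2 = r^2 := by
    rw [ha, hb, mul_pow, mul_pow, sq_abs]; linear_combination r^2 * sin_sq_add_cos_sq t
  have hw : ‖(Complex.I - ⟨a, b⟩)/(Complex.I + ⟨a,b⟩)‖ ≤ 1 := by
    rw [norm_div]
    apply div_le_one_of_le₀ _ (norm_nonneg _)
    rw [Complex.norm_def, Complex.norm_def]
    apply Real.sqrt_le_sqrt
    simp [Complex.normSq_apply]
    nlinarith
  have h := aux_avg (Real.log (a^2 + (b+1)^2)) _ hw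
  have cv := integral_image_eq_integral_abs_deriv_smul (s := Set.univ) (f := arctan)
    (f' := fun x => 1 / (1 + x^2)) MeasurableSet.univ
    (fun x _ => (hasDerivAt_arctan x).hasDerivWithinAt) arctan_injective.injOn
    (fun φ => Real.log ((tan φ - a)^2 + b^2))
  rw [Set.image_univ, range_arctan, setIntegral_univ] at cv
  have : r ^ 2 + 2 * r * |Real.sin t| + 1 = a^2 + (b+1)^2 := by
    rw [hb] at *; linear_combination -hab
  rw [this, ← h]
  trans ∫ (x : ℝ), |1 / (1 + x ^ 2)| • Real.log ((tan (arctan x) - a) ^ 2 + b ^ 2)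
  · congr 1
    ext y
    rw [tan_arctan, abs_of_pos (by positivity), smul_eq_mul,
      show r ^ 2 - 2 * r * y * Real.cos t + y ^ 2 = (y-a)^2+b^2 by rw [ha] at *; linear_combination -hab]
    ring
  rw [← cv, intervalIntegral.integral_of_le (by linarith [pi_pos]), integral_Ioc_eq_integral_Ioo]
  apply setIntegral_congr_ae measurableSet_Ioo
  filter_upwards [compl_mem_ae_iff.mpr (measure_singleton (μ := volume) (arctan a))] with φ h3 hφ
  refine aux_pt a b φ hb0 (by linarith [hφ.1]) hφ.2 fun h => h3 ?_
  rw [Set.mem_singleton_iff, ← h, arctan_tan (by linarith [hφ.1]) hφ.2]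
end

section
/- The integral over the real line ∫_{-∞}^{∞} log(−(y + i)²) · log(log y) / (y² + 1) dy equals π · log 4 · log(iπ/2), where log denotes the principal branch of the complex logarithm. -/
open Complex MeasureTheory Real

namespace ExOne

/-- The dominating function. -/
noncomputable def B (t : ℝ) : ℝ := (|t| ^ (-(1/2) : ℝ) + |t| ^ 2) * Real.exp (-|t|)

lemma B_integrable : Integrable B := by
  have h0 : IntegrableOn B (Set.Ioi 0) := by
    have h1 := Real.GammaIntegral_convergent (s := 1/2) (by norm_num)
    have h2 := Real.GammaIntegral_convergent (s := 3) (by norm_num)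
    refine (h1.add h2).congr_fun ?_ measurableSet_Ioi
    intro x hx
    have hx : 0 < x := hx
    simp only [B, Pi.add_apply, abs_of_pos hx]
    rw [show (1/2 - 1 : ℝ) = -(1/2) by norm_num, show (3 - 1 : ℝ) = (2 : ℕ) by norm_num,
      Real.rpow_natCast]
    ring
  have h1 : IntegrableOn B (Set.Iio 0) := by
    have := h0.comp_neg
    simp only [Set.neg_Ioi, neg_zero] at this
    refine this.congr_fun ?_ measurableSet_Iio
    intro x hx
    simp [B]
  rw [← integrableOn_univ, ← Set.Iio_union_Ici (a := (0:ℝ))]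
  exact h1.union ((_root_.integrableOn_Ici_iff_integrableOn_Ioi).mpr h0)

lemma B_nonneg (t : ℝ) : 0 ≤ B t := by unfold B; positivity

lemma B_neg (t : ℝ) : B (-t) = B t := by simp [B]

lemma B_tendsto : Filter.Tendsto B Filter.atTop (nhds 0) := by
  have h1 := tendsto_rpow_mul_exp_neg_mul_atTop_nhds_zero (-(1/2)) 1 (by norm_num)
  have h2 := Real.tendsto_pow_mul_exp_neg_atTop_nhds_zero 2
  have := h1.add h2
  simp only [add_zero] at this
  refine this.congr' ?_
  filter_upwards [Filter.eventually_gt_atTop 0] with t ht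
  simp only [B, abs_of_pos ht]
  ring_nf

lemma cosh_normSq (t θ : ℝ) :
    ‖Complex.cosh (t + θ * I)‖ ^ 2 = Real.sinh t ^ 2 + Real.cos θ ^ 2 := by
  rw [← Complex.normSq_eq_norm_sq, Complex.normSq_apply, Complex.cosh_add, Complex.cosh_mul_I,
    Complex.sinh_mul_I]
  simp only [← Complex.ofReal_cosh, ← Complex.ofReal_sinh, ← Complex.ofReal_cos,
    ← Complex.ofReal_sin]
  simp only [Complex.add_re, Complex.mul_re, Complex.add_im, Complex.mul_im, Complex.ofReal_re,
    Complex.ofReal_im, Complex.I_re, Complex.I_im]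
  have := Real.cosh_sq t
  have := Real.sin_sq_add_cos_sq θ
  have h3 : Real.sinh t ^ 2 * (Real.sin θ ^ 2 + Real.cos θ ^ 2) = Real.sinh t ^ 2 := by
    rw [this, mul_one]
  nlinarith

lemma cosh_lower (t θ : ℝ) (h : 1 ≤ |t| ∨ 1 / 2 ≤ Real.cos θ ^ 2) :
    Real.exp |t| / 4 ≤ ‖2 * Complex.cosh (t + θ * I)‖ := by
  rw [norm_mul, Complex.norm_ofNat]
  apply le_of_sq_le_sq _ (by positivity)
  rw [mul_pow, cosh_normSq]
  have hs : Real.sinh t ^ 2 = Real.sinh |t| ^ 2 := by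
    rcases abs_cases t with ⟨h, _⟩ | ⟨h, _⟩ <;> rw [h]
    rw [Real.sinh_neg, neg_sq]
  rw [hs]
  set u := |t|
  have hw : Real.exp u * Real.exp (-u) = 1 := by rw [← Real.exp_add]; simp
  have hwp := Real.exp_pos u
  have hvp := Real.exp_pos (-u)
  rw [Real.sinh_eq]
  rcases h with h | h
  · have h2 : 2 ≤ Real.exp u := by linarith [Real.add_one_le_exp u]
    nlinarith [sq_nonneg (Real.cos θ)]
  · nlinarith
end ExOne
namespace ExOne
/-- The constant. -/
noncomputable def c0 : ℂ := Complex.log 4 * Complex.log (I * π / 2)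

noncomputable def N (s : ℂ) : ℂ := 2 * Complex.log (1 - I * Complex.exp s) * Complex.log s - c0

noncomputable def K (s : ℂ) : ℂ := N s / (2 * Complex.cosh s)

lemma re_one_sub (t θ : ℝ) : (1 - I * Complex.exp (t + θ * I)).re = 1 + Real.exp t * Real.sin θ := by
  simp [Complex.exp_im, Complex.sub_re]

lemma norm_log_one_sub (t θ : ℝ) (h0 : 0 ≤ θ) (h1 : θ ≤ π) :
    ‖Complex.log (1 - I * Complex.exp (t + θ * I))‖ ≤ |t| + 5 := by
  set z := 1 - I * Complex.exp (t + θ * I) with hz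
  have hre : 1 ≤ z.re := by
    rw [hz, re_one_sub]
    have := Real.sin_nonneg_of_nonneg_of_le_pi h0 h1
    have := Real.exp_pos t
    nlinarith [mul_nonneg this.le (Real.sin_nonneg_of_nonneg_of_le_pi h0 h1)]
  have hn1 : 1 ≤ ‖z‖ := hre.trans (Complex.re_le_norm z)
  have hn2 : ‖z‖ ≤ 2 * Real.exp |t| := by
    have h : ‖z‖ ≤ 1 + Real.exp t := by
      refine (norm_sub_le _ _).trans ?_
      simp [Complex.norm_exp]
    have h2 : Real.exp t ≤ Real.exp |t| := Real.exp_le_exp.mpr (le_abs_self t)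
    have h3 : 1 ≤ Real.exp |t| := Real.one_le_exp (abs_nonneg t)
    linarith
  have hl : Real.log ‖z‖ ≤ 1 + |t| := by
    have := Real.log_le_log (by linarith) hn2
    rw [Real.log_mul (by norm_num) (Real.exp_pos _).ne', Real.log_exp] at this
    have := Real.log_two_lt_d9
    linarith
  have hl0 : 0 ≤ Real.log ‖z‖ := Real.log_nonneg hn1
  refine (Complex.norm_le_abs_re_add_abs_im _).trans ?_
  rw [Complex.log_re, Complex.log_im, abs_of_nonneg hl0]
  have := Complex.abs_arg_le_pi z
  have := Real.pi_lt_four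
  linarith

lemma norm_log_le (t θ : ℝ) (ht : t ≠ 0) (h0 : 0 ≤ θ) (h1 : θ ≤ π) :
    ‖Complex.log (t + θ * I)‖ ≤ abs (Real.log |t|) + |t| + 8 := by
  have hpi := Real.pi_lt_four
  set z : ℂ := t + θ * I with hz
  have hre : z.re = t := by simp [hz]
  have hn0 : |t| ≤ ‖z‖ := by rw [← hre]; exact Complex.abs_re_le_norm z
  have hn1 : ‖z‖ ≤ |t| + 4 := by
    refine (norm_add_le _ _).trans ?_
    simp [abs_of_nonneg h0]; linarith
  have htp : 0 < |t| := abs_pos.mpr ht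
  have hl : |Real.log ‖z‖| ≤ abs (Real.log |t|) + |t| + 4 := by
    rw [abs_le]; constructor
    · have := Real.log_le_log htp hn0
      have := neg_abs_le (Real.log |t|)
      linarith
    · have := Real.log_le_self (norm_nonneg z)
      have := abs_nonneg (Real.log |t|)
      linarith
  refine (Complex.norm_le_abs_re_add_abs_im _).trans ?_
  rw [Complex.log_re, Complex.log_im]
  have := Complex.abs_arg_le_pi z
  linarith

lemma poly_bound (u : ℝ) (hu : 0 < u) :
    1 ≤ u ^ (-(1/2) : ℝ) + u ^ 2 ∧
    (u + 5) * (|Real.log u| + u + 8) ≤ 66 * (u ^ (-(1/2) : ℝ) + u ^ 2) := by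
  have hp : 0 < u ^ (-(1/2) : ℝ) := by positivity
  rcases le_total u 1 with h | h
  · have h1 : 1 ≤ u ^ (-(1/2) : ℝ) := Real.one_le_rpow_of_pos_of_le_one_of_nonpos hu h (by norm_num)
    have h2 := (Real.abs_log_mul_self_rpow_lt u (1/2) hu h (by norm_num)).le
    have h3 : |Real.log u| ≤ 2 * u ^ (-(1/2) : ℝ) := by
      rw [abs_mul, abs_of_pos (by positivity : 0 < u ^ (1/2 : ℝ))] at h2
      rw [Real.rpow_neg hu.le, ← div_eq_mul_inv, le_div_iff₀ (by positivity)]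
      linarith
    constructor
    · nlinarith
    · have : |Real.log u| + u + 8 ≤ 11 * u ^ (-(1/2) : ℝ) := by linarith
      calc (u + 5) * (|Real.log u| + u + 8) ≤ 6 * (11 * u ^ (-(1/2) : ℝ)) := by gcongr; linarith
        _ ≤ _ := by nlinarith
  · have h3 : |Real.log u| ≤ u := by
      rw [abs_of_nonneg (Real.log_nonneg h)]; exact Real.log_le_self hu.le
    constructor
    · nlinarith
    · nlinarith

lemma norm_N_le : ∃ C : ℝ, 0 ≤ C ∧ ∀ t θ : ℝ, t ≠ 0 → 0 ≤ θ → θ ≤ π →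
    ‖N (t + θ * I)‖ ≤ C * (|t| ^ (-(1/2) : ℝ) + |t| ^ 2) := by
  refine ⟨132 + ‖c0‖, by positivity, fun t θ ht h0 h1 => ?_⟩
  obtain ⟨p1, p2⟩ := poly_bound |t| (abs_pos.mpr ht)
  have a1 := norm_log_one_sub t θ h0 h1
  have a2 := norm_log_le t θ ht h0 h1
  have a3 := mul_le_mul a1 a2 (norm_nonneg _) (by positivity)
  unfold N
  refine (norm_sub_le _ _).trans ?_
  rw [norm_mul, norm_mul, Complex.norm_ofNat]
  nlinarith [norm_nonneg c0]

lemma norm_K_le : ∃ C : ℝ, 0 ≤ C ∧ ∀ t θ : ℝ, t ≠ 0 → 0 ≤ θ → θ ≤ π →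
    (1 ≤ |t| ∨ 1 / 2 ≤ Real.cos θ ^ 2) → ‖K (t + θ * I)‖ ≤ C * B t := by
  obtain ⟨C, hC, h⟩ := norm_N_le
  refine ⟨4 * C, by positivity, fun t θ ht h0 h1 hc => ?_⟩
  have a1 := h t θ ht h0 h1
  have a2 := cosh_lower t θ hc
  unfold K B
  rw [norm_div]
  have he := Real.exp_pos |t|
  rw [Real.exp_neg]
  calc _ ≤ (C * (|t| ^ (-(1/2) : ℝ) + |t| ^ 2)) / (Real.exp |t| / 4) := by gcongr
    _ = _ := by field_simp

lemma K_meas (θ : ℝ) : AEStronglyMeasurable (fun t : ℝ => K (t + θ * I)) := by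
  apply Measurable.aestronglyMeasurable
  unfold K N
  fun_prop

lemma K_integrable (θ : ℝ) (h0 : 0 ≤ θ) (h1 : θ ≤ π) (hc : 1 / 2 ≤ Real.cos θ ^ 2) :
    Integrable (fun t : ℝ => K (t + θ * I)) := by
  obtain ⟨C, hC, h⟩ := norm_K_le
  refine (B_integrable.const_mul C).mono' (K_meas θ) ?_
  filter_upwards [Measure.ae_ne volume (0:ℝ)] with t ht
  exact h t θ ht h0 h1 (Or.inr hc)
end ExOne
namespace ExOne

/-- The pole. -/
noncomputable def a0 : ℂ := π / 2 * I

lemma N_a0 : N a0 = 0 := by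
  have h4 : Complex.log 4 = 2 * Complex.log 2 := by
    have h := Complex.ofReal_log (x := 4) (by norm_num)
    have h2 := Complex.ofReal_log (x := 2) (by norm_num)
    push_cast at h h2
    rw [← h, ← h2, show (4:ℝ) = 2 ^ 2 by norm_num, Real.log_pow]
    push_cast; rfl
  unfold N a0 c0
  rw [Complex.exp_pi_div_two_mul_I, h4, show (1 - I * I : ℂ) = 2 by rw [Complex.I_mul_I]; norm_num,
    show (I * π / 2 : ℂ) = π / 2 * I by ring]
  ring

lemma cosh_a0 : Complex.cosh a0 = 0 := by
  unfold a0
  rw [Complex.cosh_mul_I, Complex.cos_pi_div_two]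

def U : Set ℂ := {s | 0 < s.im ∧ s.im < 3 * π / 2 ∧ 0 < (1 - I * Complex.exp s).re}

lemma U_open : IsOpen U := by
  have h1 : IsOpen {s : ℂ | 0 < s.im} := isOpen_lt continuous_const Complex.continuous_im
  have h2 : IsOpen {s : ℂ | s.im < 3 * π / 2} := isOpen_lt Complex.continuous_im continuous_const
  have h3 : IsOpen {s : ℂ | 0 < (1 - I * Complex.exp s).re} :=
    isOpen_lt continuous_const (Complex.continuous_re.comp (by fun_prop))
  exact h1.inter (h2.inter h3)

lemma mem_U (t θ : ℝ) (h0 : 0 < θ) (h1 : θ ≤ π) : (t + θ * I : ℂ) ∈ U := by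
  refine ⟨by simpa using h0, by simp; linarith [Real.pi_pos], ?_⟩
  rw [re_one_sub]
  have := mul_nonneg (Real.exp_pos t).le (Real.sin_nonneg_of_nonneg_of_le_pi h0.le h1)
  linarith

lemma a0_mem : a0 ∈ U := by
  have := mem_U 0 (π / 2) (by positivity) (by linarith [Real.pi_pos])
  unfold a0
  simpa using this

lemma N_diff : DifferentiableOn ℂ N U := by
  intro s hs
  apply DifferentiableAt.differentiableWithinAt
  unfold N
  have h1 : (1 - I * Complex.exp s) ∈ slitPlane := Or.inl hs.2.2
  have h2 : s ∈ slitPlane := Or.inr hs.1.ne'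
  have h3 : DifferentiableAt ℂ (fun s => Complex.log (1 - I * Complex.exp s)) s :=
    DifferentiableAt.clog (by fun_prop) h1
  have h4 : DifferentiableAt ℂ (fun s => Complex.log s) s :=
    DifferentiableAt.clog (by fun_prop) h2
  exact ((h3.const_mul 2).mul h4).sub_const _

noncomputable def D (s : ℂ) : ℂ := 2 * Complex.cosh s

lemma D_diff : Differentiable ℂ D := by unfold D; fun_prop

lemma D_a0 : D a0 = 0 := by simp [D, cosh_a0]

lemma D_zero {s : ℂ} (hs : s ∈ U) (h : D s = 0) : s = a0 := by
  have h : Complex.cosh s = 0 := by simpa [D] using h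
  have e : s = s.re + s.im * I := (Complex.re_add_im s).symm
  have h2 := cosh_normSq s.re s.im
  rw [← e, h] at h2
  simp only [norm_zero] at h2
  have h3 : Real.sinh s.re = 0 := by nlinarith [sq_nonneg (Real.sinh s.re), sq_nonneg (Real.cos s.im)]
  have h4 : Real.cos s.im = 0 := by nlinarith [sq_nonneg (Real.sinh s.re), sq_nonneg (Real.cos s.im)]
  rw [Real.sinh_eq_zero] at h3
  have h5 : s.im = π / 2 := by
    rw [Real.cos_eq_zero_iff] at h4
    obtain ⟨k, hk⟩ := h4
    have p := Real.pi_pos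
    have u1 := hs.1
    have u2 := hs.2.1
    rw [hk] at u1 u2
    have k1 : (-1 : ℝ) < k := by nlinarith
    have k2 : (k : ℝ) < 1 := by nlinarith
    have k1 : -1 < k := by exact_mod_cast k1
    have k2 : k < 1 := by exact_mod_cast k2
    have : k = 0 := by omega
    rw [hk, this]; simp
  rw [e, h3, h5]; simp [a0]

noncomputable def Kd (s : ℂ) : ℂ := dslope N a0 s / dslope D a0 s

lemma Kd_eq {s : ℂ} (h : s ≠ a0) : Kd s = K s := by
  unfold Kd K
  rw [dslope_of_ne _ h, dslope_of_ne _ h, slope_def_field, slope_def_field, N_a0, D_a0, sub_zero,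
    sub_zero, div_div_div_cancel_right₀ (sub_ne_zero.mpr h)]
  rfl

lemma Kd_diff : DifferentiableOn ℂ Kd U := by
  have hU := U_open.mem_nhds a0_mem
  unfold Kd
  refine ((Complex.differentiableOn_dslope hU).mpr N_diff).div
    ((Complex.differentiableOn_dslope hU).mpr D_diff.differentiableOn) ?_
  intro s hs h
  by_cases e : s = a0
  · subst e
    rw [dslope_same] at h
    have : HasDerivAt D (2 * Complex.sinh a0) a0 := (Complex.hasDerivAt_cosh a0).const_mul 2
    rw [this.deriv] at h
    unfold a0 at h
    rw [Complex.sinh_mul_I, Complex.sin_pi_div_two] at h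
    simp at h
  · rw [dslope_of_ne _ e, slope_def_field, D_a0, sub_zero, div_eq_zero_iff] at h
    rcases h with h | h
    · exact e (D_zero hs h)
    · exact e (sub_eq_zero.mp h)

lemma ne_a0_re {t θ : ℝ} (h : t ≠ 0) : (t + θ * I : ℂ) ≠ a0 := by
  intro e
  have := congrArg Complex.re e
  simp [a0] at this
  exact h this

lemma ne_a0_im {t θ : ℝ} (h : θ ≠ π / 2) : (t + θ * I : ℂ) ≠ a0 := by
  intro e
  have := congrArg Complex.im e
  simp [a0] at this
  exact h this

lemma rect (ε : ℝ) (h0 : 0 < ε) (h1 : ε < π / 2) (R : ℝ) (hR : 1 ≤ R) :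
    (((∫ x : ℝ in (-R)..R, K (x + ε * I)) - ∫ x : ℝ in (-R)..R, K (x + π * I)) +
      I • ∫ y : ℝ in ε..π, K ((R : ℝ) + y * I)) - I • ∫ y : ℝ in ε..π, K ((-R : ℝ) + y * I) = 0 := by
  have hp := Real.pi_pos
  have h := Complex.integral_boundary_rect_eq_zero_of_differentiableOn Kd ((-R : ℝ) + ε * I)
    ((R : ℝ) + π * I) (Kd_diff.mono ?_)
  · simp only [Complex.add_re, Complex.add_im, Complex.mul_re, Complex.mul_im, Complex.ofReal_re,
      Complex.ofReal_im, Complex.I_re, Complex.I_im, mul_zero, mul_one, zero_mul, sub_zero,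
      add_zero, zero_add] at h
    simp_rw [Kd_eq (ne_a0_im h1.ne), Kd_eq (ne_a0_im (by linarith : π ≠ π / 2)),
      Kd_eq (ne_a0_re (by linarith : R ≠ 0)), Kd_eq (ne_a0_re (by linarith : -R ≠ 0))] at h
    exact h
  · intro s hs
    have h2 := hs.2
    simp only [Complex.add_re, Complex.add_im, Complex.mul_re, Complex.mul_im, Complex.ofReal_re,
      Complex.ofReal_im, Complex.I_re, Complex.I_im, mul_zero, mul_one, zero_mul, sub_zero,
      add_zero, zero_add, Set.mem_preimage] at h2
    rw [Set.uIcc_of_le (by linarith)] at h2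
    rw [← Complex.re_add_im s]
    exact mem_U _ _ (by linarith [h2.1]) h2.2

lemma vert (ε : ℝ) (h0 : 0 < ε) (h1 : ε < π / 2) (σ : ℝ) (hσ : |σ| = 1) :
    Filter.Tendsto (fun R : ℝ => ∫ y : ℝ in ε..π, K ((σ * R : ℝ) + y * I)) Filter.atTop (nhds 0) := by
  obtain ⟨C, hC, h⟩ := norm_K_le
  have hb : Filter.Tendsto (fun R => C * B R * |π - ε|) Filter.atTop (nhds 0) := by
    simpa using (B_tendsto.const_mul C).mul_const |π - ε|
  refine squeeze_zero_norm' ?_ hb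
  filter_upwards [Filter.eventually_ge_atTop 1] with R hR
  refine intervalIntegral.norm_integral_le_of_norm_le_const fun y hy => ?_
  rw [Set.uIoc_of_le (by linarith [Real.pi_pos])] at hy
  have hab : |σ * R| = R := by rw [abs_mul, hσ, one_mul, abs_of_nonneg (by linarith)]
  have hB : B (σ * R) = B R := by
    unfold B; rw [hab, abs_of_nonneg (by linarith : 0 ≤ R)]
  rw [← hB]
  refine h _ _ ?_ (by linarith [hy.1]) hy.2 (Or.inl (by rw [hab]; exact hR))
  intro e
  rw [e, abs_zero] at hab
  linarith

lemma shift (ε : ℝ) (h0 : 0 < ε) (h1 : ε ≤ π / 4) :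
    ∫ t : ℝ, K (t + ε * I) = ∫ t : ℝ, K (t + π * I) := by
  have hp := Real.pi_pos
  have hcos : 1 / 2 ≤ Real.cos ε ^ 2 := by
    have h := Real.cos_le_cos_of_nonneg_of_le_pi h0.le (by linarith) h1
    rw [Real.cos_pi_div_four] at h
    have h2 : (0:ℝ) ≤ √2 / 2 := by positivity
    have h3 := pow_le_pow_left₀ h2 h 2
    rw [div_pow, Real.sq_sqrt (by norm_num)] at h3
    linarith
  have i1 := K_integrable ε h0.le (by linarith) hcos
  have i2 := K_integrable π hp.le le_rfl (by simp; norm_num)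
  have t1 := intervalIntegral_tendsto_integral i1 Filter.tendsto_neg_atTop_atBot Filter.tendsto_id
  have t2 := intervalIntegral_tendsto_integral i2 Filter.tendsto_neg_atTop_atBot Filter.tendsto_id
  have v1 := (vert ε h0 (by linarith) 1 (by simp)).const_smul I
  have v2 := (vert ε h0 (by linarith) (-1) (by simp)).const_smul I
  have T := ((t1.sub t2).add v1).sub v2
  have T2 := T.congr' (f₂ := fun _ => (0:ℂ)) (by
    filter_upwards [Filter.eventually_ge_atTop 1] with R hR
    have := rect ε h0 (by linarith) R hR
    simpa using this)
  have := tendsto_nhds_unique T2 tendsto_const_nhds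
  simp only [smul_zero, add_zero, sub_zero] at this
  exact sub_eq_zero.mp this

lemma limit_pt (t : ℝ) (ht : t ≠ 0) :
    Filter.Tendsto (fun ε : ℝ => K (t + ε * I)) (nhdsWithin 0 (Set.Ioi 0)) (nhds (K t)) := by
  have hc : Filter.Tendsto (fun ε : ℝ => (t + ε * I : ℂ)) (nhdsWithin 0 (Set.Ioi 0)) (nhds t) := by
    have : Continuous (fun ε : ℝ => (t + ε * I : ℂ)) := by fun_prop
    have := this.tendsto 0
    simp only [Complex.ofReal_zero, zero_mul, add_zero] at this
    exact this.mono_left nhdsWithin_le_nhds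
  have hl : Filter.Tendsto (fun ε : ℝ => Complex.log (t + ε * I : ℂ)) (nhdsWithin 0 (Set.Ioi 0))
      (nhds (Complex.log t)) := by
    rcases lt_or_gt_of_ne ht with h | h
    · have := Complex.continuousWithinAt_log_of_re_neg_of_im_zero (z := t) (by simpa) (by simp)
      refine this.tendsto.comp (tendsto_nhdsWithin_iff.mpr ⟨hc, ?_⟩)
      filter_upwards [self_mem_nhdsWithin] with ε hε
      simpa using (le_of_lt hε)
    · exact (continuousAt_clog (Or.inl (by simpa))).tendsto.comp hc
  have he : ContinuousAt (fun s => Complex.log (1 - I * Complex.exp s)) (t : ℂ) := by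
    refine ContinuousAt.clog (by fun_prop) (Or.inl ?_)
    have := re_one_sub t 0
    simp at this
    rw [Complex.sub_re, Complex.one_re]
    simp [Complex.exp_im]
  have hd : ContinuousAt (fun s => 2 * Complex.cosh s) (t : ℂ) := by fun_prop
  have hd0 : 2 * Complex.cosh t ≠ 0 := by
    rw [← Complex.ofReal_cosh]
    have := (Real.cosh_pos t).ne'
    exact mul_ne_zero two_ne_zero (Complex.ofReal_ne_zero.mpr this)
  unfold K N
  exact ((((he.tendsto.comp hc).const_mul 2).mul hl).sub_const c0).div (hd.tendsto.comp hc) hd0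

lemma zero_eq_pi : ∫ t : ℝ, K t = ∫ t : ℝ, K (t + π * I) := by
  obtain ⟨C, hC, h⟩ := norm_K_le
  have hp := Real.pi_pos
  have hev : ∀ᶠ ε in nhdsWithin (0:ℝ) (Set.Ioi 0), 0 < ε ∧ ε ≤ π / 4 := by
    filter_upwards [Ioo_mem_nhdsGT (by positivity : (0:ℝ) < π / 4)] with ε hε
    exact ⟨hε.1, hε.2.le⟩
  have T : Filter.Tendsto (fun ε : ℝ => ∫ t : ℝ, K (t + ε * I)) (nhdsWithin 0 (Set.Ioi 0))
      (nhds (∫ t : ℝ, K t)) := by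
    refine tendsto_integral_filter_of_dominated_convergence (fun t => C * B t)
      (Filter.Eventually.of_forall K_meas) ?_ (B_integrable.const_mul C) ?_
    · filter_upwards [hev] with ε ⟨h0, h1⟩
      filter_upwards [Measure.ae_ne volume (0:ℝ)] with t ht
      refine h t ε ht h0.le (by linarith) (Or.inr ?_)
      have h := Real.cos_le_cos_of_nonneg_of_le_pi h0.le (by linarith) h1
      rw [Real.cos_pi_div_four] at h
      have h2 : (0:ℝ) ≤ √2 / 2 := by positivity
      have h3 := pow_le_pow_left₀ h2 h 2
      rw [div_pow, Real.sq_sqrt (by norm_num)] at h3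
      linarith
    · filter_upwards [Measure.ae_ne volume (0:ℝ)] with t ht
      exact limit_pt t ht
  have T2 := T.congr' (f₂ := fun _ => ∫ t : ℝ, K (t + π * I)) (by
    filter_upwards [hev] with ε ⟨h0, h1⟩
    exact shift ε h0 h1)
  exact tendsto_nhds_unique T2 tendsto_const_nhds |>.symm ▸ rfl

/-- The integrand with the constant subtracted. -/
noncomputable def g (y : ℝ) : ℂ :=
  (Complex.log (-((y : ℂ) + I) ^ 2) * Complex.log (Complex.log y) - c0) / ((y : ℂ) ^ 2 + 1)

lemma log_sq (y : ℝ) : Complex.log (-((y : ℂ) + I) ^ 2) = 2 * Complex.log (1 - I * y) := by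
  have h : -((y : ℂ) + I) ^ 2 = (1 - I * y) ^ 2 := by
    have := Complex.I_sq
    linear_combination (-(y:ℂ)^2 - 1) * this
  have hne : (1 - I * y : ℂ) ≠ 0 := by
    intro e; have := congrArg Complex.re e; simp at this
  have hre : 0 < (1 - I * y : ℂ).re := by simp
  have ha := abs_lt.mp (Complex.abs_arg_lt_pi_div_two_iff.mpr (Or.inl hre))
  rw [h]
  conv_lhs => rw [← Complex.exp_log hne, ← Complex.exp_nat_mul]
  rw [Complex.log_exp]
  · simp
  · simp [Complex.log_im]; linarith
  · simp [Complex.log_im]; linarith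

lemma g_pos (t : ℝ) : |Real.exp t| • g (Real.exp t) = K t := by
  rw [abs_of_pos (Real.exp_pos t)]
  unfold g K N
  rw [log_sq, Complex.real_smul]
  have hl : Complex.log (Real.exp t : ℝ) = t := by
    rw [← Complex.ofReal_log (Real.exp_pos t).le, Real.log_exp]
  rw [hl, Complex.cosh, Complex.ofReal_exp, Complex.exp_neg]
  have h1 := Complex.exp_ne_zero (t : ℂ)
  have h2 : Complex.exp (t:ℂ) ^ 2 + 1 ≠ 0 := by
    rw [← Complex.ofReal_exp]; norm_cast; positivity
  field_simp

lemma g_neg (t : ℝ) : |-Real.exp t| • g (-Real.exp t) = -K (t + π * I) := by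
  rw [abs_neg, abs_of_pos (Real.exp_pos t)]
  unfold g K N
  rw [log_sq, Complex.real_smul]
  have he : Complex.exp (t + π * I) = -Complex.exp t := by
    rw [Complex.exp_add, Complex.exp_pi_mul_I]; ring
  have hl : Complex.log (-Real.exp t : ℝ) = t + π * I := by
    rw [Complex.ofReal_neg, Complex.ofReal_exp, ← he, Complex.log_exp] <;> simp
    linarith [Real.pi_pos]
  rw [hl, Complex.cosh, Complex.exp_neg, he, Complex.ofReal_neg, Complex.ofReal_exp]
  have h1 := Complex.exp_ne_zero (t : ℂ)
  have h2 : Complex.exp (t:ℂ) ^ 2 + 1 ≠ 0 := by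
    rw [← Complex.ofReal_exp]; norm_cast; positivity
  have h3 : 2 * ((-Complex.exp (t:ℂ) + (-Complex.exp (t:ℂ))⁻¹) / 2)
      = -((Complex.exp (t:ℂ) ^ 2 + 1) / Complex.exp t) := by
    rw [inv_neg]; field_simp; ring
  rw [h3, neg_sq]
  field_simp

lemma img_pos : Real.exp '' Set.univ = Set.Ioi 0 := by
  rw [Set.image_univ, Real.range_exp]

lemma img_neg : (fun t => -Real.exp t) '' Set.univ = Set.Iio 0 := by
  ext y
  simp only [Set.image_univ, Set.mem_range, Set.mem_Iio]
  constructor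
  · rintro ⟨t, rfl⟩; simpa using Real.exp_pos t
  · intro h
    exact ⟨Real.log (-y), by rw [Real.exp_log (by linarith)]; ring⟩

lemma g_main : Integrable g ∧ ∫ y, g y = 0 := by
  have d1 : ∀ x ∈ Set.univ, HasDerivWithinAt Real.exp (Real.exp x) Set.univ x :=
    fun x _ => (Real.hasDerivAt_exp x).hasDerivWithinAt
  have d2 : ∀ x ∈ Set.univ, HasDerivWithinAt (fun t => -Real.exp t) (-Real.exp x) Set.univ x :=
    fun x _ => (Real.hasDerivAt_exp x).neg.hasDerivWithinAt
  have j1 : Set.InjOn Real.exp Set.univ := Real.exp_injective.injOn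
  have j2 : Set.InjOn (fun t => -Real.exp t) Set.univ :=
    (neg_injective.comp Real.exp_injective).injOn
  have k0 : Integrable (fun t : ℝ => K t) := by
    simpa using K_integrable 0 le_rfl Real.pi_pos.le (by simp; norm_num)
  have kp : Integrable (fun t : ℝ => K (t + π * I)) :=
    K_integrable π Real.pi_pos.le le_rfl (by simp; norm_num)
  have i1 := (integrableOn_image_iff_integrableOn_abs_deriv_smul MeasurableSet.univ d1 j1 g)
  have i2 := (integrableOn_image_iff_integrableOn_abs_deriv_smul MeasurableSet.univ d2 j2 g)
  have e1 := integral_image_eq_integral_abs_deriv_smul MeasurableSet.univ d1 j1 g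
  have e2 := integral_image_eq_integral_abs_deriv_smul MeasurableSet.univ d2 j2 g
  simp only [g_pos, img_pos, integrableOn_univ, setIntegral_univ] at i1 e1
  simp only [g_neg, img_neg, integrableOn_univ, setIntegral_univ] at i2 e2
  have i1 := i1.mpr k0
  have i2 := i2.mpr kp.neg
  have i1' : IntegrableOn g (Set.Ici 0) := (_root_.integrableOn_Ici_iff_integrableOn_Ioi).mpr i1
  have hdis : Disjoint (Set.Iio (0:ℝ)) (Set.Ici 0) :=
    Set.disjoint_left.mpr fun x h1 h2 => (not_lt.mpr (Set.mem_Ici.mp h2)) (Set.mem_Iio.mp h1)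
  constructor
  · rw [← integrableOn_univ, ← Set.Iio_union_Ici (a := (0:ℝ))]
    exact i2.union i1'
  · rw [← setIntegral_univ, ← Set.Iio_union_Ici (a := (0:ℝ)),
      setIntegral_union hdis
        measurableSet_Ici i2 i1',
      integral_Ici_eq_integral_Ioi, e1, e2, integral_neg, zero_eq_pi]
    ring
end ExOne

theorem example_one :
    ∫ y : ℝ, Complex.log (-((y : ℂ) + I) ^ 2) * Complex.log (Complex.log y) /
        ((y : ℂ) ^ 2 + 1) =
      (π : ℂ) * Complex.log 4 * Complex.log (I * π / 2) := by
  obtain ⟨hi, h0⟩ := ExOne.g_main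
  have hint : Integrable (fun y : ℝ => ExOne.c0 * (((1 + y ^ 2)⁻¹ : ℝ) : ℂ)) :=
    (integrable_inv_one_add_sq.ofReal).const_mul _
  have hval : ∫ y : ℝ, ExOne.c0 * (((1 + y ^ 2)⁻¹ : ℝ) : ℂ) = ExOne.c0 * π := by
    rw [integral_const_mul, integral_complex_ofReal, integral_univ_inv_one_add_sq]
  have := integral_add hi hint
  rw [h0, hval, zero_add] at this
  rw [mul_assoc, mul_comm]
  change _ = ExOne.c0 * π
  rw [← this]
  congr 1
  funext y
  unfold ExOne.g
  push_cast
  rw [add_comm (1:ℂ), ← div_eq_mul_inv, ← add_div]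
  ring
end

section
/- The integral over the real line ∫_{-∞}^{∞} (log y)^{1/2} · log(−(y + i)²) · log(log y) / (y² + 1) dy equals (1 + i) · π^{3/2} · log 2 · ( log(π/2) + iπ/2 ), where log denotes the principal branch of the complex logarithm and (log y)^{1/2} is the principal complex square root of log y. -/
open Complex MeasureTheory Real

lemma change_var (g h0 h1 : ℝ → ℂ) (i0 : Integrable h0) (i1 : Integrable h1)
    (e0 : ∀ x : ℝ, (Real.exp x) • g (Real.exp x) = h0 x)
    (e1 : ∀ x : ℝ, (Real.exp x) • g (-Real.exp x) = h1 x) :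
    Integrable g ∧ ∫ y, g y = (∫ x, h0 x) + ∫ x, h1 x := by
  have im0 : Real.exp '' Set.univ = Set.Ioi 0 := by rw [Set.image_univ, Real.range_exp]
  have im1 : (fun x => -Real.exp x) '' Set.univ = Set.Iio 0 := by
    ext y
    simp only [Set.image_univ, Set.mem_range, Set.mem_Iio]
    constructor
    · rintro ⟨x, rfl⟩
      have := Real.exp_pos x
      linarith
    · intro hy
      exact ⟨Real.log (-y), by rw [Real.exp_log (by linarith)]; ring⟩
  have d0 : ∀ x ∈ Set.univ, HasDerivWithinAt Real.exp (Real.exp x) Set.univ x :=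
    fun x _ => (Real.hasDerivAt_exp x).hasDerivWithinAt
  have d1 : ∀ x ∈ Set.univ, HasDerivWithinAt (fun x => -Real.exp x) (-Real.exp x) Set.univ x :=
    fun x _ => (Real.hasDerivAt_exp x).neg.hasDerivWithinAt
  have j0 : Set.InjOn Real.exp Set.univ := Real.exp_injective.injOn
  have j1 : Set.InjOn (fun x => -Real.exp x) Set.univ :=
    (neg_injective.comp Real.exp_injective).injOn
  have k0 := integrableOn_image_iff_integrableOn_abs_deriv_smul MeasurableSet.univ d0 j0 g
  have k1 := integrableOn_image_iff_integrableOn_abs_deriv_smul MeasurableSet.univ d1 j1 g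
  have l0 := integral_image_eq_integral_abs_deriv_smul MeasurableSet.univ d0 j0 g
  have l1 := integral_image_eq_integral_abs_deriv_smul MeasurableSet.univ d1 j1 g
  rw [im0] at k0 l0
  rw [im1] at k1 l1
  simp only [abs_neg, Real.abs_exp, e0, e1, integrableOn_univ, Measure.restrict_univ] at k0 k1 l0 l1
  have m0 : IntegrableOn g (Set.Ioi 0) := k0.2 i0
  have m1 : IntegrableOn g (Set.Iic 0) := (integrableOn_Iic_iff_integrableOn_Iio (by simp)).2 (k1.2 i1)
  refine ⟨?_, ?_⟩
  · rw [← integrableOn_univ, ← Set.Iic_union_Ioi (a := (0:ℝ))]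
    exact m1.union m0
  · rw [← intervalIntegral.integral_Iic_add_Ioi m1 m0, integral_Iic_eq_integral_Iio, l0, l1, add_comm]

/-- The closed strip. -/
def strip : Set ℂ := {w | 0 ≤ w.im ∧ w.im ≤ π}
/-- The open strip. -/
def ostrip : Set ℂ := {w | 0 < w.im ∧ w.im < π}

lemma line_integrable (H : ℂ → ℂ) (hc : ContinuousOn H strip) (C : ℝ)
    (hb : ∀ w ∈ strip, 1 ≤ |w.re| → ‖H w‖ ≤ C * Real.exp (-|w.re| / 2)) (t : ℝ)
    (ht : 0 ≤ t ∧ t ≤ π) : Integrable (fun x : ℝ => H (x + t * I)) := by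
  have hm : ∀ x : ℝ, (x + t * I : ℂ) ∈ strip := fun x => by simpa [strip] using ht
  have cont : Continuous (fun x : ℝ => H (x + t * I)) :=
    hc.comp_continuous (by fun_prop) hm
  refine cont.locallyIntegrable.integrable_of_isBigO_atBot_atTop
    (g := fun x => Real.exp ((1/2) * x)) (g' := fun x => Real.exp ((-1/2) * x)) ?_ ?_ ?_ ?_
  · refine Asymptotics.IsBigO.of_bound C ?_
    filter_upwards [Filter.eventually_le_atBot (-1)] with x hx
    have h2 : |x| = -x := abs_of_nonpos (by linarith)
    have := hb _ (hm x) (by simp [h2]; linarith)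
    simp [h2] at this
    rw [Real.norm_eq_abs, Real.abs_exp]
    convert this using 3
    ring
  · exact ⟨Set.Iic 0, Filter.Iic_mem_atBot 0, integrableOn_exp_mul_Iic (by norm_num) 0⟩
  · refine Asymptotics.IsBigO.of_bound C ?_
    filter_upwards [Filter.eventually_ge_atTop 1] with x hx
    have h2 : |x| = x := abs_of_nonneg (by linarith)
    have := hb _ (hm x) (by simp [h2]; linarith)
    simp [h2] at this
    rw [Real.norm_eq_abs, Real.abs_exp]
    convert this using 3
    ring
  · exact ⟨Set.Ioi 0, Filter.Ioi_mem_atTop 0, integrableOn_exp_mul_Ioi (by norm_num) 0⟩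

lemma strip_shift (H : ℂ → ℂ) (hc : ContinuousOn H strip) (hd : DifferentiableOn ℂ H ostrip) (C : ℝ)
    (hb : ∀ w ∈ strip, 1 ≤ |w.re| → ‖H w‖ ≤ C * Real.exp (-|w.re| / 2)) :
    ∫ x : ℝ, H x = ∫ x : ℝ, H (x + π * I) := by
  have i0 := line_integrable H hc C hb 0 ⟨le_rfl, Real.pi_pos.le⟩
  have i1 := line_integrable H hc C hb π ⟨Real.pi_pos.le, le_rfl⟩
  simp only [ofReal_zero, zero_mul, add_zero] at i0
  have T0 := intervalIntegral_tendsto_integral i0 Filter.tendsto_neg_atTop_atBot Filter.tendsto_id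
  have T1 := intervalIntegral_tendsto_integral i1 Filter.tendsto_neg_atTop_atBot Filter.tendsto_id
  simp only [id] at T0 T1
  have key : ∀ R : ℝ, 1 ≤ R → ‖(∫ x in -R..R, H (x:ℝ)) - ∫ x in -R..R, H ((x:ℝ) + π * I)‖
      ≤ 2 * (C * Real.exp (-R/2) * π) := by
    intro R hR
    have := Complex.integral_boundary_rect_eq_zero_of_continuousOn_of_differentiableOn H
      (-(R:ℝ) : ℂ) ((R:ℝ) + π * I) ?_ ?_
    · simp only [neg_re, ofReal_re, neg_im, ofReal_im, neg_zero, add_re, mul_re, I_re, mul_zero,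
        I_im, mul_one, sub_self, add_zero, add_im, mul_im, zero_add, ofReal_zero, zero_mul] at this
      have b : ∀ S : ℝ, |S| = R → ‖∫ y in (0:ℝ)..π, H ((S:ℝ) + (y:ℝ) * I)‖
          ≤ C * Real.exp (-R/2) * π := by
        intro S hS
        have := intervalIntegral.norm_integral_le_of_norm_le_const (a := 0) (b := π)
          (f := fun y : ℝ => H ((S:ℝ) + (y:ℝ) * I)) (C := C * Real.exp (-R/2)) ?_
        · simpa [abs_of_pos Real.pi_pos] using this
        · intro y hy
          rw [Set.uIoc_of_le Real.pi_pos.le] at hy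
          have := hb (S + y * I) (by simp [strip, hy.1.le, hy.2]) (by simpa [hS] using hR)
          simpa [hS] using this
      have b1 := b R (abs_of_pos (by linarith))
      have b2 := b (-R) (by rw [abs_neg, abs_of_pos (by linarith)])
      have e : (∫ x in -R..R, H (x:ℝ)) - ∫ x in -R..R, H ((x:ℝ) + π * I) =
        I • (∫ y in (0:ℝ)..π, H ((-R:ℝ) + (y:ℝ) * I)) - I • ∫ y in (0:ℝ)..π, H ((R:ℝ) + (y:ℝ) * I) := by
        linear_combination this
      rw [e]
      refine (norm_sub_le _ _).trans ?_
      rw [norm_smul, norm_smul, norm_I]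
      linarith
    · refine hc.mono ?_
      intro z hz
      rw [mem_reProdIm] at hz
      have := hz.2
      simp [Set.uIcc_of_le Real.pi_pos.le] at this
      exact this
    · refine hd.mono ?_
      intro z hz
      rw [mem_reProdIm] at hz
      have := hz.2
      simp [Real.pi_pos.le] at this
      exact this
  have Z : Filter.Tendsto (fun R : ℝ => 2 * (C * Real.exp (-R/2) * π)) Filter.atTop (nhds 0) := by
    have : Filter.Tendsto (fun R : ℝ => Real.exp (-R/2)) Filter.atTop (nhds 0) := by
      refine Real.tendsto_exp_atBot.comp ?_
      exact Filter.tendsto_neg_atTop_atBot.atBot_div_const (by norm_num)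
    simpa using ((this.const_mul C).mul_const π).const_mul 2
  have Z2 : Filter.Tendsto (fun R : ℝ => (∫ x in -R..R, H (x:ℝ)) - ∫ x in -R..R, H ((x:ℝ) + π * I))
      Filter.atTop (nhds 0) := by
    refine squeeze_zero_norm' ?_ Z
    filter_upwards [Filter.eventually_ge_atTop 1] with R hR using key R hR
  exact sub_eq_zero.1 (tendsto_nhds_unique (T0.sub T1) Z2)

lemma sqrtlog_norm (w : ℂ) : ‖w ^ ((1:ℂ)/2) * Complex.log w‖ ≤
    2 * |√‖w‖ * Real.log (√‖w‖)| + π * √‖w‖ := by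
  have h1 : ‖w ^ ((1:ℂ)/2)‖ = √‖w‖ := by
    have := norm_cpow_real w (1/2)
    rw [Real.sqrt_eq_rpow, ← this]; norm_num
  have h2 : ‖Complex.log w‖ ≤ |Real.log ‖w‖| + π := by
    refine (norm_le_abs_re_add_abs_im _).trans ?_
    rw [log_re, log_im]
    gcongr
    exact abs_arg_le_pi w
  rw [norm_mul, h1, Real.log_sqrt (norm_nonneg _), abs_mul, abs_of_nonneg (Real.sqrt_nonneg _),
    abs_div, abs_two]
  nlinarith [Real.sqrt_nonneg ‖w‖]

lemma sqrtlog_cont : ContinuousOn (fun w : ℂ => w ^ ((1:ℂ)/2) * Complex.log w) {w | 0 ≤ w.im} := by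
  intro w hw
  by_cases h0 : w = 0
  · subst h0
    apply ContinuousAt.continuousWithinAt
    rw [ContinuousAt]
    simp only [Complex.log_zero, mul_zero]
    refine squeeze_zero_norm sqrtlog_norm ?_
    have : Continuous (fun w : ℂ => 2 * |√‖w‖ * Real.log (√‖w‖)| + π * √‖w‖) := by
      have := Real.continuous_mul_log.comp (Real.continuous_sqrt.comp (continuous_norm (E := ℂ)))
      simp only [Function.comp_def] at this
      fun_prop
    simpa using this.tendsto 0
  · have hl : ContinuousWithinAt Complex.log {w | 0 ≤ w.im} w := by
      by_cases hs : w ∈ slitPlane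
      · exact (continuousAt_clog hs).continuousWithinAt
      · rw [mem_slitPlane_iff] at hs
        push Not at hs
        refine continuousWithinAt_log_of_re_neg_of_im_zero ?_ hs.2
        refine lt_of_le_of_ne hs.1 ?_
        intro h
        exact h0 (Complex.ext h hs.2)
    have : ContinuousWithinAt (fun w => cexp (Complex.log w * (1/2)) * Complex.log w)
        {w | 0 ≤ w.im} w := by fun_prop
    refine this.congr_of_eventuallyEq ?_ ?_
    · filter_upwards [mem_nhdsWithin_of_mem_nhds (isOpen_ne.mem_nhds h0)] with z hz
      rw [cpow_def_of_ne_zero hz]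
    · rw [cpow_def_of_ne_zero h0]

/-- The holomorphic function on the strip. -/
noncomputable def FF (w : ℂ) : ℂ :=
  w ^ ((1:ℂ)/2) * Complex.log w * (2 * Complex.log (1 - I * cexp w))

/-- The pole. -/
noncomputable def cc : ℂ := (π / 2 : ℝ) * I

lemma cc_mem : cc ∈ ostrip := by
  have := Real.pi_pos
  simp [cc, ostrip]
  linarith

lemma ostrip_sub : ostrip ⊆ strip := fun _ h => ⟨h.1.le, h.2.le⟩

lemma ostrip_open : IsOpen ostrip :=
  (isOpen_lt continuous_const continuous_im).inter (isOpen_lt continuous_im continuous_const)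

lemma one_le_re {w : ℂ} (hw : w ∈ strip) : 1 ≤ (1 - I * cexp w).re := by
  have := Real.sin_nonneg_of_nonneg_of_le_pi hw.1 hw.2
  have h2 := Real.exp_pos w.re
  simp [exp_im]
  positivity

lemma FF_cont : ContinuousOn FF strip := by
  refine (sqrtlog_cont.mono fun w hw => hw.1).mul (continuousOn_const.mul ?_)
  refine ContinuousOn.clog (by fun_prop) ?_
  intro w hw
  exact Or.inl (by linarith [one_le_re hw])

lemma FF_diff : DifferentiableOn ℂ FF ostrip := by
  intro w hw
  have h1 : w ∈ slitPlane := Or.inr hw.1.ne'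
  have h2 : 1 - I * cexp w ∈ slitPlane := Or.inl (by linarith [one_le_re (ostrip_sub hw)])
  apply DifferentiableAt.differentiableWithinAt
  unfold FF
  refine DifferentiableAt.mul (DifferentiableAt.mul ?_ (differentiableAt_id.clog h1)) ?_
  · exact differentiableAt_id.cpow_const h1
  · have hd : DifferentiableAt ℂ (fun w => 1 - I * cexp w) w := by fun_prop
    exact (hd.clog h2).const_mul 2

lemma cosh_cc : Complex.cosh cc = 0 := by
  rw [cc, Complex.cosh_mul_I, ← ofReal_cos, Real.cos_pi_div_two, ofReal_zero]

lemma cosh_ne {w : ℂ} (hw : w ∈ strip) (h : w ≠ cc) : Complex.cosh w ≠ 0 := by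
  intro h0
  have e : Complex.cosh w = Real.cosh w.re * Real.cos w.im + Real.sinh w.re * Real.sin w.im * I := by
    conv_lhs => rw [← re_add_im w]
    rw [Complex.cosh_add, Complex.cosh_mul_I, Complex.sinh_mul_I]
    push_cast; ring
  rw [e] at h0
  have hr := congrArg re h0
  have hi := congrArg im h0
  simp [-ofReal_cosh, -ofReal_sinh, -ofReal_cos, -ofReal_sin] at hr hi
  have hc : Real.cos w.im = 0 := hr.resolve_left (Real.cosh_pos _).ne'
  have him : w.im = π / 2 := by
    have := Real.pi_pos
    refine Real.injOn_cos ⟨hw.1, hw.2⟩ ⟨by linarith, by linarith⟩ ?_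
    rw [hc, Real.cos_pi_div_two]
  rw [him, Real.sin_pi_div_two] at hi
  have hre : w.re = 0 := by simpa using hi
  exact h (Complex.ext (by simp [hre, cc]) (by simp [him, cc]))

/-- The quotient with removed singularity. -/
noncomputable def HH (w : ℂ) : ℂ := dslope FF cc w / (2 * dslope Complex.cosh cc w)

lemma HH_eq {w : ℂ} (h : w ≠ cc) : HH w = (FF w - FF cc) / (2 * Complex.cosh w) := by
  have := sub_ne_zero.2 h
  rw [HH, dslope_of_ne _ h, dslope_of_ne _ h, slope_def_field, slope_def_field, cosh_cc]
  rw [sub_zero, mul_div_assoc', div_div_div_cancel_right₀ this]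

lemma dcosh_ne {w : ℂ} (hw : w ∈ strip) : 2 * dslope Complex.cosh cc w ≠ 0 := by
  by_cases h : w = cc
  · subst h
    rw [dslope_same, Complex.deriv_cosh, cc, Complex.sinh_mul_I, ← ofReal_sin, Real.sin_pi_div_two]
    simp
  · rw [dslope_of_ne _ h, slope_def_field, cosh_cc, sub_zero]
    exact mul_ne_zero two_ne_zero (div_ne_zero (cosh_ne hw h) (sub_ne_zero.2 h))

lemma HH_cont : ContinuousOn HH strip := by
  have hn : strip ∈ nhds cc := Filter.mem_of_superset (ostrip_open.mem_nhds cc_mem) ostrip_sub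
  refine ContinuousOn.div ?_ (continuousOn_const.mul ?_) fun w hw => dcosh_ne hw
  · exact (continuousOn_dslope hn).2 ⟨FF_cont, FF_diff.differentiableAt (ostrip_open.mem_nhds cc_mem)⟩
  · exact (continuousOn_dslope hn).2 ⟨Complex.continuous_cosh.continuousOn,
      Complex.differentiable_cosh _⟩

lemma HH_diff : DifferentiableOn ℂ HH ostrip := by
  have hn : ostrip ∈ nhds cc := ostrip_open.mem_nhds cc_mem
  refine DifferentiableOn.div ?_ (DifferentiableOn.const_mul ?_ _) fun w hw => dcosh_ne (ostrip_sub hw)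
  · exact (differentiableOn_dslope hn).2 FF_diff
  · exact (differentiableOn_dslope hn).2 Complex.differentiable_cosh.differentiableOn

lemma norm_log_bd {w : ℂ} (h : 1 ≤ ‖w‖) : ‖Complex.log w‖ ≤ Real.log ‖w‖ + π := by
  refine (norm_le_abs_re_add_abs_im _).trans ?_
  rw [log_re, log_im, abs_of_nonneg (Real.log_nonneg h)]
  gcongr
  exact abs_arg_le_pi w

lemma FF_bd {w : ℂ} (hw : w ∈ strip) (h : 1 ≤ |w.re|) : ‖FF w‖ ≤ 1024 * Real.exp (|w.re| / 2) := by
  have hp := Real.pi_lt_d2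
  have hn1 : 1 ≤ ‖w‖ := h.trans (abs_re_le_norm w)
  have hn2 : ‖w‖ ≤ |w.re| + π := by
    refine (norm_le_abs_re_add_abs_im _).trans ?_
    rw [abs_of_nonneg hw.1]
    linarith [hw.2]
  set t := |w.re| with ht
  have a1 : ‖w ^ ((1:ℂ)/2)‖ ≤ t + 8 := by
    have := norm_cpow_real w (1/2)
    have e : ‖w ^ ((1:ℂ)/2)‖ = √‖w‖ := by
      rw [Real.sqrt_eq_rpow, ← this]; norm_num
    rw [e]
    have : √‖w‖ ≤ ‖w‖ := Real.sqrt_le_self_iff.2 (Or.inr hn1)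
    linarith
  have a2 : ‖Complex.log w‖ ≤ t + 8 := by
    have := norm_log_bd hn1
    have := Real.log_le_sub_one_of_pos (by linarith : 0 < ‖w‖)
    linarith
  have a3 : ‖Complex.log (1 - I * cexp w)‖ ≤ t + 8 := by
    have h1 : 1 ≤ ‖1 - I * cexp w‖ := (one_le_re hw).trans ((le_abs_self _).trans (abs_re_le_norm _))
    have h2 := norm_log_bd h1
    have h3 : ‖1 - I * cexp w‖ ≤ Real.exp (t + 1) := by
      refine (norm_sub_le _ _).trans ?_
      rw [norm_mul, norm_I, norm_exp, norm_one, one_mul, Real.exp_add]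
      have q1 : Real.exp w.re ≤ Real.exp t := Real.exp_le_exp.2 (le_abs_self _)
      have q2 : 1 ≤ Real.exp t := Real.one_le_exp (by positivity)
      have q3 := Real.add_one_le_exp 1
      nlinarith
    have h4 : Real.log ‖1 - I * cexp w‖ ≤ t + 1 := by
      rw [Real.log_le_iff_le_exp (by linarith)]; exact h3
    linarith
  have a4 : (1 + t / 6) ^ 3 ≤ Real.exp (t / 2) := by
    have : Real.exp (t/2) = Real.exp (t/6) ^ 3 := by
      rw [← Real.exp_nat_mul]; congr 1; push_cast; ring
    rw [this]
    have := Real.add_one_le_exp (t/6)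
    gcongr
    linarith
  calc ‖FF w‖ = ‖w ^ ((1:ℂ)/2)‖ * ‖Complex.log w‖ * (2 * ‖Complex.log (1 - I * cexp w)‖) := by
        simp [FF]
    _ ≤ (t + 8) * (t + 8) * (2 * (t + 8)) := by gcongr
    _ = 2 * (t + 8) ^ 3 := by ring
    _ ≤ 2 * (8 * (1 + t / 6)) ^ 3 := by gcongr; linarith
    _ = 1024 * (1 + t / 6) ^ 3 := by ring
    _ ≤ _ := by gcongr

lemma cosh_bd {w : ℂ} (h : 1 ≤ |w.re|) : Real.exp |w.re| / 2 ≤ ‖2 * Complex.cosh w‖ := by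
  have e : 2 * Complex.cosh w = cexp w + cexp (-w) := by rw [Complex.cosh]; ring
  have h1 := norm_sub_norm_le (cexp w) (-cexp (-w))
  have h2 := norm_sub_norm_le (cexp (-w)) (-cexp w)
  rw [e]
  simp only [sub_neg_eq_add, norm_neg, norm_exp, neg_re] at h1 h2
  rw [add_comm] at h2
  have k : Real.exp (-|w.re|) ≤ 1 := Real.exp_le_one_iff.2 (by linarith)
  have k2 := Real.add_one_le_exp |w.re|
  rcases abs_cases w.re with ⟨h, _⟩ | ⟨h, _⟩ <;> rw [h] at k k2 ⊢
  · linarith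
  · rw [neg_neg] at k
    linarith

lemma HH_bd : ∀ w ∈ strip, 1 ≤ |w.re| →
    ‖HH w‖ ≤ (2 * (1024 + ‖FF cc‖)) * Real.exp (-|w.re| / 2) := by
  intro w hw h
  have hne : w ≠ cc := by
    rintro rfl
    simp [cc] at h
    linarith
  rw [HH_eq hne, norm_div]
  have b1 := FF_bd hw h
  have b2 := cosh_bd h
  have e1 := Real.exp_pos (|w.re|)
  have e2 : 1 ≤ Real.exp (|w.re|/2) := Real.one_le_exp (by positivity)
  rw [div_le_iff₀ (by linarith)]
  have e3 : Real.exp (-|w.re| / 2) * Real.exp |w.re| = Real.exp (|w.re|/2) := by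
    rw [← Real.exp_add]; congr 1; ring
  calc ‖FF w - FF cc‖ ≤ ‖FF w‖ + ‖FF cc‖ := norm_sub_le _ _
    _ ≤ 1024 * Real.exp (|w.re| / 2) + ‖FF cc‖ * Real.exp (|w.re| / 2) := by
        gcongr
        exact le_mul_of_one_le_right (norm_nonneg _) e2
    _ = (2 * (1024 + ‖FF cc‖)) * Real.exp (-|w.re| / 2) * (Real.exp |w.re| / 2) := by
        rw [← e3]; ring
    _ ≤ _ := by gcongr

lemma log_sq (y : ℝ) : Complex.log (-((y : ℂ) + I) ^ 2) = 2 * Complex.log (1 - I * y) := by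
  have e : -((y : ℂ) + I) ^ 2 = (1 - I * y) ^ 2 := by
    linear_combination (-(y:ℂ)^2 - 1) * I_sq
  have hr : 0 < (1 - I * (y:ℂ)).re := by simp
  have h := Complex.abs_arg_lt_pi_div_two_iff.2 (Or.inl hr)
  rw [abs_lt] at h
  have hne : 1 - I * (y:ℂ) ≠ 0 := by
    intro h0
    simp [h0] at hr
  have e2 : (1 - I * (y:ℂ)) ^ 2 = cexp (2 * Complex.log (1 - I * y)) := by
    rw [two_mul, Complex.exp_add, Complex.exp_log hne, sq]
  have him : (2 * Complex.log (1 - I * (y:ℂ))).im = 2 * (1 - I * (y:ℂ)).arg := by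
    rw [← log_im]; simp
  rw [e, e2, Complex.log_exp]
  · rw [him]; linarith
  · rw [him]; linarith

lemma FF_cc : (π : ℂ) * FF cc = (1 + I) * (π : ℂ) ^ ((3 : ℂ) / 2) * Complex.log 2 *
        (Complex.log ((π : ℂ) / 2) + I * π / 2) := by
  have hp := Real.pi_pos
  have hl : Complex.log cc = Complex.log ((π : ℂ) / 2) + I * π / 2 := by
    rw [cc, Complex.log_ofReal_mul (by positivity) I_ne_zero, Complex.log_I]
    have : (π:ℂ)/2 = ((π/2 : ℝ) : ℂ) := by push_cast; rfl
    rw [this, Complex.ofReal_log (by positivity)]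
    push_cast
    ring
  have hs : (π:ℂ) * (cc ^ ((1:ℂ)/2) * 2) = (1 + I) * (π : ℂ) ^ ((3 : ℂ) / 2) := by
    have h2 : (1 + I) = (√2 : ℝ) * cexp (π/4 * I) := by
      rw [Complex.exp_mul_I]
      have : (π:ℂ)/4 = ((π/4 : ℝ) : ℂ) := by push_cast; rfl
      rw [this, ← ofReal_cos, ← ofReal_sin, Real.cos_pi_div_four, Real.sin_pi_div_four]
      have : ((√2:ℝ):ℂ) * (√2:ℝ) = 2 := by
        rw [← ofReal_mul, Real.mul_self_sqrt (by norm_num)]; norm_num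
      push_cast
      linear_combination (-(1 + I) / 2) * this
    have h3 : (π : ℂ) ^ ((3 : ℂ) / 2) = π * (√π : ℝ) := by
      have : (3:ℂ)/2 = 1 + 1/2 := by norm_num
      rw [this, cpow_add _ _ (by exact_mod_cast hp.ne'), cpow_one, Real.sqrt_eq_rpow,
        ofReal_cpow hp.le]
      norm_num
    have h4 : cc ^ ((1:ℂ)/2) = (√(π/2) : ℝ) * cexp (π/4 * I) := by
      have hc0 : cc ≠ 0 := by simp [cc, hp.ne']
      rw [cpow_def_of_ne_zero hc0, cc, Complex.log_ofReal_mul (by positivity) I_ne_zero,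
        Complex.log_I, Real.sqrt_eq_rpow, Real.rpow_def_of_pos (by positivity), ofReal_exp,
        ← Complex.exp_add]
      congr 1
      push_cast
      ring
    have h5 : ((√(π/2) : ℝ) : ℂ) * 2 = (√2 : ℝ) * (√π : ℝ) := by
      rw [← ofReal_mul, ← ofReal_ofNat, ← ofReal_mul]
      congr 1
      rw [Real.sqrt_div hp.le]
      have : √2 * √2 = 2 := Real.mul_self_sqrt (by norm_num)
      field_simp
      linarith
    rw [h2, h3, h4]
    linear_combination (π * cexp (π/4 * I)) * h5
  have he : 1 - I * cexp cc = 2 := by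
    rw [cc]
    push_cast
    rw [Complex.exp_pi_div_two_mul_I]
    linear_combination -I_sq
  rw [FF, he, hl, ← hs]
  ring

theorem example_two :
    ∫ y : ℝ, (Complex.log y) ^ ((1 : ℂ) / 2) * Complex.log (-((y : ℂ) + I) ^ 2) *
        Complex.log (Complex.log y) / ((y : ℂ) ^ 2 + 1) =
      (1 + I) * (π : ℂ) ^ ((3 : ℂ) / 2) * Complex.log 2 *
        (Complex.log ((π : ℂ) / 2) + I * π / 2) := by
  have hp := Real.pi_pos
  rw [← FF_cc]
  have i0 := line_integrable HH HH_cont _ HH_bd 0 ⟨le_rfl, hp.le⟩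
  have i1 := line_integrable HH HH_cont _ HH_bd π ⟨hp.le, le_rfl⟩
  simp only [ofReal_zero, zero_mul, add_zero] at i0
  have hsh := strip_shift HH HH_cont HH_diff _ HH_bd
  set G : ℝ → ℂ := fun y => (Complex.log y) ^ ((1 : ℂ) / 2) * Complex.log (-((y : ℂ) + I) ^ 2) *
        Complex.log (Complex.log y) / ((y : ℂ) ^ 2 + 1) with hG
  have hsq : ∀ y : ℝ, (y:ℂ)^2 + 1 ≠ 0 := fun y => by
    have : (y^2 + 1 : ℝ) ≠ 0 := by positivity
    exact_mod_cast this
  have hGF : ∀ (y : ℝ) (w : ℂ), w.im = 0 ∨ w.im = π → cexp w = y → G y = FF w / ((y:ℂ)^2+1) := by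
    intro y w hw he
    have hl : Complex.log y = w := by
      rw [← he]
      apply Complex.log_exp <;> rcases hw with h | h <;> rw [h] <;> linarith
    simp only [hG]
    rw [hl, log_sq, FF, he]
    ring
  set g : ℝ → ℂ := fun y => G y - FF cc * ((1 + y^2 : ℝ)⁻¹ : ℝ) with hg
  have hgF : ∀ (y : ℝ) (w : ℂ), w.im = 0 ∨ w.im = π → cexp w = y → cexp w * g y = HH w := by
    intro y w hw he
    have hne : w ≠ cc := by
      intro hwc
      have h1 : w.im = π / 2 := by rw [hwc]; simp [cc]
      rcases hw with h | h <;> linarith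
    rw [HH_eq hne, hg]
    simp only []
    rw [hGF y w hw he]
    have e : 2 * Complex.cosh w = (y^2+1)/y := by
      rw [Complex.cosh, Complex.exp_neg, he]
      have : (y:ℂ) ≠ 0 := he ▸ Complex.exp_ne_zero w
      field_simp
    rw [e, he]
    have := hsq y
    have h3 : (1 + (y:ℂ)^2) ≠ 0 := by rwa [add_comm]
    push_cast
    rw [add_comm (1:ℂ)]
    field_simp
  obtain ⟨ig, eg⟩ := change_var g (fun x => HH x) (fun x => -HH (x + π * I)) i0 i1.neg
    (by
      intro x
      rw [← hgF (Real.exp x) x (by simp) (by simp)]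
      simp)
    (by
      intro x
      rw [← hgF (-Real.exp x) (x + π * I) (by simp) (by simp [Complex.exp_add])]
      simp [Complex.exp_add])
  have ii : Integrable (fun y : ℝ => FF cc * ((1 + y^2 : ℝ)⁻¹ : ℝ)) :=
    (integrable_inv_one_add_sq.ofReal).const_mul _
  have eG : G = fun y => g y + FF cc * ((1 + y^2 : ℝ)⁻¹ : ℝ) := by
    funext y; simp [hg]
  rw [eG, integral_add ig ii, eg, integral_neg, hsh, integral_const_mul]
  have hpi : ∫ y : ℝ, (((1 + y^2 : ℝ)⁻¹ : ℝ) : ℂ) = (π : ℂ) := by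
    rw [← integral_univ_inv_one_add_sq]
    exact integral_complex_ofReal
  rw [hpi]
  ring
end

section
/- The integral over the real line ∫_{-∞}^{∞} y · log(log y) / ( (1 − i y) · (y² + 4) ) dy equals (1/3) · i · π · log( log 2 + iπ/2 ), where log denotes the principal branch of the complex logarithm. -/
open Complex MeasureTheory Real
open Filter Topology Set

lemma aux_log_cont {z : ℂ} (hz : z ≠ 0) (h : 0 ≤ z.im) :
    ContinuousWithinAt Complex.log {w : ℂ | 0 ≤ w.im} z := by
  by_cases hs : z ∈ slitPlane
  · exact (continuousAt_clog hs).continuousWithinAt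
  · rw [Complex.mem_slitPlane_iff] at hs
    push Not at hs
    have : z.re ≠ 0 := fun h0 => hz (Complex.ext h0 hs.2)
    exact continuousWithinAt_log_of_re_neg_of_im_zero (lt_of_le_of_ne hs.1 this) hs.2

lemma aux_log_ne {z : ℂ} (hz : z ≠ 0) (h1 : z ≠ 1) : Complex.log z ≠ 0 := by
  intro h
  apply h1
  rw [← Complex.exp_log hz, h, Complex.exp_zero]

lemma aux_LL_cont {z : ℂ} (hz : z ≠ 0) (h1 : z ≠ 1) (h : 0 ≤ z.im) :
    ContinuousWithinAt (fun w => Complex.log (Complex.log w)) {w : ℂ | 0 ≤ w.im} z := by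
  have hm : MapsTo Complex.log {w : ℂ | 0 ≤ w.im} {w : ℂ | 0 ≤ w.im} := by
    intro w hw
    simp only [mem_ofPred_eq, Complex.log_im] at hw ⊢
    exact Complex.arg_nonneg_iff.2 hw
  exact (aux_log_cont (aux_log_ne hz h1) (hm h)).comp (aux_log_cont hz h) hm

lemma aux_log_im_pos {z : ℂ} (h : 0 < z.im) : 0 < (Complex.log z).im := by
  rw [Complex.log_im]
  apply lt_of_le_of_ne (Complex.arg_nonneg_iff.2 h.le)
  intro h0
  have := (Complex.arg_eq_zero_iff.1 h0.symm).2
  linarith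

lemma aux_LL_diff {z : ℂ} (h : 0 < z.im) :
    DifferentiableAt ℂ (fun w => Complex.log (Complex.log w)) z := by
  have h1 : z ∈ slitPlane := Complex.mem_slitPlane_iff.2 (Or.inr h.ne')
  have h2 : Complex.log z ∈ slitPlane :=
    Complex.mem_slitPlane_iff.2 (Or.inr (aux_log_im_pos h).ne')
  exact (differentiableAt_id.clog h1).clog h2

lemma aux_reallog {r : ℝ} (hr : 0 < r) : Real.log r ≤ 2 * √r := by
  have h := Real.log_le_sub_one_of_pos (Real.sqrt_pos.2 hr)
  rw [Real.log_sqrt hr.le] at h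
  linarith

lemma aux_reallog' {r : ℝ} (hr : 0 < r) : -Real.log r ≤ 2 * (√r)⁻¹ := by
  have h := aux_reallog (inv_pos.2 hr)
  rwa [Real.log_inv, Real.sqrt_inv] at h

lemma aux_norm_log (w : ℂ) : ‖Complex.log w‖ ≤ |Real.log ‖w‖| + π := by
  refine (Complex.norm_le_abs_re_add_abs_im _).trans ?_
  rw [Complex.log_re, Complex.log_im]
  gcongr
  exact Complex.abs_arg_le_pi w

lemma aux_LL_bound {z : ℂ} (hz : z ≠ 0) (h1 : z ≠ 1) :
    ‖Complex.log (Complex.log z)‖ ≤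
      2 * √‖z‖ + 2 * (√‖z‖)⁻¹ + 4 * (√‖z - 1‖)⁻¹ + (2 * π + 2) := by
  set w := Complex.log z with hw
  have hw0 : w ≠ 0 := aux_log_ne hz h1
  have hwp : 0 < ‖w‖ := norm_pos_iff.2 hw0
  have hzp : 0 < ‖z‖ := norm_pos_iff.2 hz
  have hz1 : 0 < ‖z - 1‖ := norm_pos_iff.2 (sub_ne_zero.2 h1)
  have a1 := aux_norm_log w
  have a2 := aux_norm_log z
  rw [← hw] at a2
  have b1 : |Real.log ‖z‖| ≤ 2 * √‖z‖ + 2 * (√‖z‖)⁻¹ := by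
    have := aux_reallog hzp
    have := aux_reallog' hzp
    have : 0 ≤ √‖z‖ := Real.sqrt_nonneg _
    have : 0 ≤ (√‖z‖)⁻¹ := by positivity
    rw [abs_le]; constructor <;> linarith
  have b2 : |Real.log ‖w‖| ≤ ‖w‖ + 2 * (√‖w‖)⁻¹ := by
    have := Real.log_le_sub_one_of_pos hwp
    have := aux_reallog' hwp
    have : 0 ≤ (√‖w‖)⁻¹ := by positivity
    rw [abs_le]; constructor <;> linarith
  have b3 : (√‖w‖)⁻¹ ≤ 1 + 2 * (√‖z - 1‖)⁻¹ := by
    have hp : 0 ≤ (√‖z - 1‖)⁻¹ := by positivity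
    by_cases hle : ‖w‖ ≤ 1
    · have := Complex.norm_exp_sub_one_le hle
      rw [hw, Complex.exp_log hz, ← hw] at this
      have h4 : ‖z - 1‖ ≤ 2 ^ 2 * ‖w‖ := by linarith
      have h5 : √‖z - 1‖ ≤ 2 * √‖w‖ := by
        have := Real.sqrt_le_sqrt h4
        rwa [Real.sqrt_mul (by norm_num), Real.sqrt_sq (by norm_num)] at this
      have h6 : 0 < √‖z - 1‖ := Real.sqrt_pos.2 hz1
      have h7 : 0 < √‖w‖ := Real.sqrt_pos.2 hwp
      have : (√‖w‖)⁻¹ ≤ 2 * (√‖z - 1‖)⁻¹ := by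
        rw [← div_eq_mul_inv, inv_eq_one_div, div_le_div_iff₀ h7 h6]
        linarith
      linarith
    · have : (√‖w‖)⁻¹ ≤ 1 := inv_le_one_of_one_le₀ (Real.one_le_sqrt.2 (not_le.1 hle).le)
      linarith
  linarith

/-- the kernel -/
noncomputable def auxK (z : ℂ) : ℂ := z / ((1 - I * z) * (z ^ 2 + 4))

lemma auxK_norm (z : ℂ) : ‖auxK z‖ = ‖z‖ / (‖z + I‖ * (‖z - 2 * I‖ * ‖z + 2 * I‖)) := by
  have h1 : 1 - I * z = -I * (z + I) := by ring_nf; simp; ring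
  have h2 : z ^ 2 + 4 = (z - 2 * I) * (z + 2 * I) := by ring_nf; simp; ring
  rw [auxK, h1, h2]; simp

lemma aux_nsq (z : ℂ) : ‖z‖ ^ 2 = z.re ^ 2 + z.im ^ 2 := by
  rw [← Complex.normSq_eq_norm_sq, Complex.normSq_apply]; ring

lemma aux_norm_add {z : ℂ} (h : 0 ≤ z.im) : ‖z‖ ≤ ‖z + 2 * I‖ ∧ ‖z‖ ≤ ‖z + I‖ := by
  constructor <;>
  · apply (sq_le_sq₀ (norm_nonneg _) (norm_nonneg _)).1
    rw [aux_nsq, aux_nsq]; simp; nlinarith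

lemma auxK_bound {z : ℂ} (h : 0 ≤ z.im) (h' : z.im ≤ 1) : ‖auxK z‖ ≤ (1 + z.re ^ 2)⁻¹ := by
  rw [auxK_norm]
  have e1 : √(1 + z.re ^ 2) ≤ ‖z + I‖ := by
    apply Real.sqrt_le_iff.2 ⟨norm_nonneg _, ?_⟩
    rw [aux_nsq]; simp; nlinarith
  have e2 : √(1 + z.re ^ 2) ≤ ‖z - 2 * I‖ := by
    apply Real.sqrt_le_iff.2 ⟨norm_nonneg _, ?_⟩
    rw [aux_nsq]; simp; nlinarith
  have e3 := (aux_norm_add h).1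
  have e0 : 0 < √(1 + z.re ^ 2) := Real.sqrt_pos.2 (by positivity)
  have e4 : 0 < ‖z + 2 * I‖ := by
    apply norm_pos_iff.2; intro h0
    have := congrArg Complex.im h0; simp at this; linarith
  have e5 : 1 + z.re ^ 2 ≤ ‖z + I‖ * ‖z - 2 * I‖ := by
    rw [← Real.mul_self_sqrt (show 0 ≤ 1 + z.re ^ 2 by positivity)]
    gcongr
  calc _ ≤ ‖z + 2 * I‖ / ((1 + z.re ^ 2) * ‖z + 2 * I‖) := by
        rw [← mul_assoc]; gcongr
    _ = _ := by field_simp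

lemma auxK_bound' {z : ℂ} (h : 0 ≤ z.im) (h' : 4 ≤ ‖z‖) : ‖auxK z‖ ≤ 2 / ‖z‖ ^ 2 := by
  rw [auxK_norm]
  have e3 := (aux_norm_add h).1
  have e2 := (aux_norm_add h).2
  have e1 : ‖z‖ / 2 ≤ ‖z - 2 * I‖ := by
    have := norm_sub_norm_le z (2 * I)
    simp at this; linarith
  have : 0 < ‖z‖ := by linarith
  calc _ ≤ ‖z‖ / (‖z‖ * (‖z‖ / 2 * ‖z‖)) := by gcongr
    _ = _ := by field_simp

lemma aux_int_sing (a : ℝ) : Integrable (fun x : ℝ => (1 + x ^ 2)⁻¹ * (√|x - a|)⁻¹) := by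
  have hi : IntegrableOn (fun x : ℝ => |x - a| ^ (-(1/2) : ℝ)) (Icc (a - 1) (a + 1)) := by
    have h0 : IntervalIntegrable (fun x : ℝ => (x : ℂ) ^ (((-(1/2) : ℝ)) : ℂ)) volume (-1) 1 :=
      intervalIntegral.intervalIntegrable_cpow' (by norm_num)
    have h1 := h0.norm.comp_sub_right a
    rw [intervalIntegrable_iff_integrableOn_Icc_of_le (by linarith)] at h1
    have h2 : (fun x : ℝ => |x - a| ^ (-(1/2) : ℝ)) =
        fun x : ℝ => ‖((x - a : ℝ) : ℂ) ^ (((-(1/2) : ℝ)) : ℂ)‖ := by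
      funext x
      rw [Complex.norm_cpow_real, Complex.norm_real, Real.norm_eq_abs]
    rw [h2, show a - 1 = -1 + a by ring, add_comm a 1]
    exact h1
  have hi2 := (hi.integrable_indicator measurableSet_Icc).add integrable_inv_one_add_sq
  refine hi2.mono' (by fun_prop) (ae_of_all _ fun x => ?_)
  have p1 : (1 + x ^ 2)⁻¹ ≤ 1 := inv_le_one_of_one_le₀ (by nlinarith)
  have p2 : 0 ≤ (√|x - a|)⁻¹ := by positivity
  have p3 : 0 < (1 + x ^ 2)⁻¹ := by positivity
  rw [Real.norm_of_nonneg (by positivity)]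
  simp only [Pi.add_apply, indicator]
  split_ifs with hx
  · rw [Real.rpow_neg (abs_nonneg _), ← Real.sqrt_eq_rpow]
    nlinarith
  · have : (√|x - a|)⁻¹ ≤ 1 := by
      apply inv_le_one_of_one_le₀ (Real.one_le_sqrt.2 _)
      by_contra hc
      rw [not_le, abs_lt] at hc
      exact hx ⟨by linarith, by linarith⟩
    nlinarith

lemma aux_int_growth : Integrable (fun x : ℝ => (1 + x ^ 2)⁻¹ * √(1 + |x|)) := by
  have h : Integrable (fun x : ℝ => (1 + ‖x‖) ^ (-(3 / 2) : ℝ)) :=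
    integrable_one_add_norm (by simp; norm_num)
  refine (h.const_mul 2).mono' (by fun_prop) (ae_of_all _ fun x => ?_)
  rw [Real.norm_of_nonneg (by positivity), Real.norm_eq_abs]
  have hp : 0 < 1 + |x| := by positivity
  have e : (1 + |x|) ^ (-(3 / 2) : ℝ) = ((1 + |x|) ^ 2)⁻¹ * √(1 + |x|) := by
    rw [Real.sqrt_eq_rpow, ← Real.rpow_natCast, ← Real.rpow_neg hp.le, ← Real.rpow_add hp]
    norm_num
  rw [e, ← mul_assoc]
  gcongr
  rw [← div_eq_mul_inv, inv_eq_one_div, div_le_div_iff₀ (by positivity) (by positivity)]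
  nlinarith [sq_nonneg (|x| - 1), sq_abs x]

lemma aux_meas_K : Measurable auxK := by
  unfold auxK; fun_prop

lemma aux_int_K : Integrable (fun x : ℝ => auxK x) := by
  refine integrable_inv_one_add_sq.mono' ?_ (ae_of_all _ fun x => ?_)
  · exact (aux_meas_K.comp Complex.measurable_ofReal).aestronglyMeasurable
  · simpa using auxK_bound (z := (x : ℂ)) (by simp) (by simp)

lemma aux_integral_K : ∫ x : ℝ, auxK x = I * π / 3 := by
  have h1 : ∫ x : ℝ, auxK ((-x : ℝ) : ℂ) = ∫ x : ℝ, auxK x :=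
    integral_neg_eq_self (fun x : ℝ => auxK x) volume
  have h2 : ∫ x : ℝ, (auxK x + auxK ((-x : ℝ) : ℂ)) = 2 * ∫ x : ℝ, auxK x := by
    rw [integral_add aux_int_K aux_int_K.comp_neg, h1, two_mul]
  have h3 : ∀ x : ℝ, auxK x + auxK ((-x : ℝ) : ℂ) =
      (2 * I / 3) * (((1 + (x / 2) ^ 2)⁻¹ - (1 + x ^ 2)⁻¹ : ℝ) : ℂ) := by
    intro x
    have a1 : (1 - I * x : ℂ) ≠ 0 := by
      intro h; have := congrArg Complex.re h; simp at this
    have a2 : (1 + I * x : ℂ) ≠ 0 := by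
      intro h; have := congrArg Complex.re h; simp at this
    have a3 : ((x : ℂ) ^ 2 + 4) ≠ 0 := by
      have : (x ^ 2 + 4 : ℝ) ≠ 0 := by positivity
      exact_mod_cast this
    have a6 : (1 + (x : ℂ) ^ 2) ≠ 0 := by
      have : (1 + x ^ 2 : ℝ) ≠ 0 := by positivity
      exact_mod_cast this
    have a4 : (1 + ((x : ℂ) / 2) ^ 2) = (x ^ 2 + 4) / 4 := by ring
    have i1 : (1 - I * x : ℂ)⁻¹ = (1 + I * x) / (1 + (x : ℂ) ^ 2) := by
      rw [inv_eq_one_div, div_eq_div_iff a1 a6]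
      linear_combination (x : ℂ) ^ 2 * Complex.I_sq
    have i2 : (1 + I * x : ℂ)⁻¹ = (1 - I * x) / (1 + (x : ℂ) ^ 2) := by
      rw [inv_eq_one_div, div_eq_div_iff a2 a6]
      linear_combination (x : ℂ) ^ 2 * Complex.I_sq
    unfold auxK
    push_cast
    rw [a4, mul_neg, sub_neg_eq_add, neg_sq, ← div_div, ← div_div, div_eq_mul_inv (x : ℂ),
      div_eq_mul_inv (-x : ℂ), i1, i2]
    field_simp
    ring
  have h4 : ∫ x : ℝ, (1 + (x / 2) ^ 2)⁻¹ = 2 * π := by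
    have := MeasureTheory.Measure.integral_comp_div (fun x : ℝ => (1 + x ^ 2)⁻¹) 2
    rw [this, integral_univ_inv_one_add_sq]; simp
  have h5 : Integrable (fun x : ℝ => (1 + (x / 2) ^ 2)⁻¹) :=
    integrable_inv_one_add_sq.comp_div (by norm_num)
  simp_rw [h3] at h2
  rw [integral_const_mul, integral_complex_ofReal, integral_sub h5 integrable_inv_one_add_sq, h4,
    integral_univ_inv_one_add_sq] at h2
  push_cast at h2
  linear_combination -h2 / 2

/-- log log -/
noncomputable def auxL (z : ℂ) : ℂ := Complex.log (Complex.log z)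

/-- integrand with the pole removed (away from `2i`) -/
noncomputable def auxF (z : ℂ) : ℂ := auxK z * (auxL z - auxL (2 * I))

/-- holomorphic version -/
noncomputable def auxG (z : ℂ) : ℂ :=
  z / ((1 - I * z) * (z + 2 * I)) * dslope auxL (2 * I) z

lemma auxG_eq {z : ℂ} (hz : z ≠ 2 * I) : auxG z = auxF z := by
  rw [auxG, auxF, dslope_of_ne _ hz, slope_def_field, auxK]
  have h2 : z ^ 2 + 4 = (z - 2 * I) * (z + 2 * I) := by ring_nf; simp; ring
  rw [h2, div_mul_div_comm, div_mul_eq_mul_div]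
  congr 1
  ring

lemma auxG_diff : DifferentiableOn ℂ auxG {z : ℂ | 0 < z.im} := by
  have hO : IsOpen {z : ℂ | 0 < z.im} := isOpen_lt continuous_const Complex.continuous_im
  have hL : DifferentiableOn ℂ (dslope auxL (2 * I)) {z : ℂ | 0 < z.im} := by
    rw [Complex.differentiableOn_dslope (hO.mem_nhds (by simp))]
    exact fun z hz => (aux_LL_diff hz).differentiableWithinAt
  refine DifferentiableOn.mul ?_ hL
  refine DifferentiableOn.div (by fun_prop) (by fun_prop) ?_
  intro z hz
  have hz : 0 < z.im := hz
  apply mul_ne_zero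
  · intro h; have := congrArg Complex.re h; simp at this; linarith
  · intro h; have := congrArg Complex.im h; simp at this; linarith

/-- dominating function -/
noncomputable def auxB (x : ℝ) : ℝ :=
  2 * ((1 + x ^ 2)⁻¹ * √(1 + |x|)) + 2 * ((1 + x ^ 2)⁻¹ * (√|x - 0|)⁻¹) +
    4 * ((1 + x ^ 2)⁻¹ * (√|x - 1|)⁻¹) + (2 * π + 2 + ‖auxL (2 * I)‖) * (1 + x ^ 2)⁻¹

lemma auxB_int : Integrable auxB :=
  (((aux_int_growth.const_mul 2).add ((aux_int_sing 0).const_mul 2)).add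
    ((aux_int_sing 1).const_mul 4)).add (integrable_inv_one_add_sq.const_mul _)

lemma auxF_bound {x e : ℝ} (h0 : x ≠ 0) (h1 : x ≠ 1) (he : 0 ≤ e) (he1 : e ≤ 1) :
    ‖auxF (x + e * I)‖ ≤ auxB x := by
  set z : ℂ := x + e * I with hz
  have hre : z.re = x := by simp [hz]
  have him : z.im = e := by simp [hz]
  have z0 : z ≠ 0 := fun h => h0 (by rw [← hre, h]; rfl)
  have z1 : z ≠ 1 := fun h => h1 (by rw [← hre, h]; rfl)
  have b1 := aux_LL_bound z0 z1
  have b2 := auxK_bound (z := z) (by rw [him]; exact he) (by rw [him]; exact he1)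
  rw [hre] at b2
  have c1 : ‖z‖ ≤ 1 + |x| := by
    have := Complex.norm_le_abs_re_add_abs_im z
    rw [hre, him, abs_of_nonneg he] at this; linarith
  have c2 : |x - 0| ≤ ‖z‖ := by rw [sub_zero, ← hre]; exact Complex.abs_re_le_norm z
  have c3 : |x - 1| ≤ ‖z - 1‖ := by
    have := Complex.abs_re_le_norm (z - 1)
    simpa [hre] using this
  have d1 : √‖z‖ ≤ √(1 + |x|) := Real.sqrt_le_sqrt c1
  have d2 : (√‖z‖)⁻¹ ≤ (√|x - 0|)⁻¹ :=
    inv_anti₀ (Real.sqrt_pos.2 (by simpa using h0)) (Real.sqrt_le_sqrt c2)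
  have d3 : (√‖z - 1‖)⁻¹ ≤ (√|x - 1|)⁻¹ :=
    inv_anti₀ (Real.sqrt_pos.2 (abs_pos.2 (sub_ne_zero.2 h1))) (Real.sqrt_le_sqrt c3)
  have e1 : ‖auxL z - auxL (2 * I)‖ ≤ 2 * √(1 + |x|) + 2 * (√|x - 0|)⁻¹ + 4 * (√|x - 1|)⁻¹
      + (2 * π + 2 + ‖auxL (2 * I)‖) := by
    have := norm_sub_le (auxL z) (auxL (2 * I))
    have b1' : ‖auxL z‖ ≤ _ := b1
    linarith
  rw [auxF, norm_mul]
  calc _ ≤ (1 + x ^ 2)⁻¹ * (2 * √(1 + |x|) + 2 * (√|x - 0|)⁻¹ + 4 * (√|x - 1|)⁻¹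
      + (2 * π + 2 + ‖auxL (2 * I)‖)) := by gcongr
    _ = auxB x := by unfold auxB; ring

lemma ae_ne_real (a : ℝ) : ∀ᵐ x : ℝ, x ≠ a := by
  simp [ae_iff]

lemma aux_meas_F : Measurable auxF := by
  have : Measurable auxL := Complex.measurable_log.comp Complex.measurable_log
  exact aux_meas_K.mul (this.sub_const _)

lemma auxF_ae_bound {e : ℝ} (he : 0 ≤ e) (he1 : e ≤ 1) :
    ∀ᵐ x : ℝ, ‖auxF (x + e * I)‖ ≤ auxB x := by
  filter_upwards [ae_ne_real 0, ae_ne_real 1] with x h0 h1 using auxF_bound h0 h1 he he1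

lemma aux_meas_Fe (e : ℝ) : AEStronglyMeasurable (fun x : ℝ => auxF (x + e * I)) :=
  (aux_meas_F.comp (by fun_prop)).aestronglyMeasurable

lemma auxF_int {e : ℝ} (he : 0 ≤ e) (he1 : e ≤ 1) :
    Integrable (fun x : ℝ => auxF (x + e * I)) :=
  auxB_int.mono' (aux_meas_Fe e) (auxF_ae_bound he he1)

lemma auxF_tendsto : Tendsto (fun e : ℝ => ∫ x : ℝ, auxF (x + e * I)) (𝓝[>] 0)
    (𝓝 (∫ x : ℝ, auxF x)) := by
  refine tendsto_integral_filter_of_dominated_convergence auxB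
    (Eventually.of_forall aux_meas_Fe) ?_ auxB_int ?_
  · filter_upwards [Ioo_mem_nhdsGT (zero_lt_one (α := ℝ))] with e he
    exact auxF_ae_bound he.1.le he.2.le
  · filter_upwards [ae_ne_real 0, ae_ne_real 1] with x h0 h1
    have hm : Tendsto (fun e : ℝ => (x : ℂ) + e * I) (𝓝[>] 0) (𝓝[{w : ℂ | 0 ≤ w.im}] (x : ℂ)) := by
      apply tendsto_nhdsWithin_of_tendsto_nhds_of_eventually_within
      · have : Continuous (fun e : ℝ => (x : ℂ) + e * I) := by fun_prop
        have h := this.tendsto 0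
        simp only [Complex.ofReal_zero, zero_mul, add_zero] at h
        exact h.mono_left nhdsWithin_le_nhds
      · filter_upwards [self_mem_nhdsWithin] with e he
        have : (0:ℝ) < e := he
        simpa using this.le
    have hL : ContinuousWithinAt auxL {w : ℂ | 0 ≤ w.im} (x : ℂ) :=
      aux_LL_cont (by exact_mod_cast h0) (by exact_mod_cast h1) (by simp)
    have hK : ContinuousAt auxK (x : ℂ) := by
      unfold auxK
      refine ContinuousAt.div (by fun_prop) (by fun_prop) (mul_ne_zero ?_ ?_)
      · intro h; have := congrArg Complex.re h; simp at this
      · have : (x ^ 2 + 4 : ℝ) ≠ 0 := by positivity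
        exact_mod_cast this
    have hF : ContinuousWithinAt auxF {w : ℂ | 0 ≤ w.im} (x : ℂ) :=
      hK.continuousWithinAt.mul (hL.sub continuousWithinAt_const)
    exact hF.tendsto.comp hm

lemma auxG_far : ∃ C : ℝ, 0 ≤ C ∧ ∀ R : ℝ, 4 ≤ R → ∀ z : ℂ, 0 ≤ z.im → R ≤ ‖z‖ →
    ‖auxG z‖ ≤ C / (R * √R) := by
  refine ⟨2 * (2 + 2 + 4 + (2 * π + 2) + ‖auxL (2 * I)‖), by positivity, ?_⟩
  intro R hR z him hz
  have hz4 : 4 ≤ ‖z‖ := hR.trans hz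
  have z2 : z ≠ 2 * I := by rintro rfl; simp at hz4; norm_num at hz4
  have z0 : z ≠ 0 := by rintro rfl; simp at hz4; norm_num at hz4
  have z1 : z ≠ 1 := by rintro rfl; norm_num at hz4
  have hs : 1 ≤ √‖z‖ := Real.one_le_sqrt.2 (by linarith)
  have b1 : ‖auxL z‖ ≤ _ := aux_LL_bound z0 z1
  have b2 := auxK_bound' him hz4
  have b3 : (√‖z‖)⁻¹ ≤ 1 := inv_le_one_of_one_le₀ hs
  have b4 : (√‖z - 1‖)⁻¹ ≤ 1 := by
    apply inv_le_one_of_one_le₀ (Real.one_le_sqrt.2 _)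
    have := norm_sub_norm_le z 1
    simp at this; linarith
  have b5 := norm_sub_le (auxL z) (auxL (2 * I))
  have b6 : ‖auxL z - auxL (2 * I)‖ ≤ (2 + 2 + 4 + (2 * π + 2) + ‖auxL (2 * I)‖) * √‖z‖ := by
    have := Real.pi_pos
    have := norm_nonneg (auxL (2 * I))
    nlinarith
  rw [auxG_eq z2, auxF, norm_mul]
  have hzp : 0 < ‖z‖ := by linarith
  set D := (2 + 2 + 4 + (2 * π + 2) + ‖auxL (2 * I)‖) with hD
  have hDn : 0 ≤ D := by positivity
  calc _ ≤ 2 / ‖z‖ ^ 2 * (D * √‖z‖) := by gcongr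
    _ = 2 * D / (‖z‖ * √‖z‖) := by
        have : √‖z‖ * √‖z‖ = ‖z‖ := Real.mul_self_sqrt hzp.le
        have h0 : √‖z‖ ≠ 0 := by positivity
        field_simp
        linear_combination D * this
    _ ≤ _ := by gcongr

lemma auxG_zero {e : ℝ} (he : 0 < e) (he1 : e ≤ 1) : ∫ x : ℝ, auxF (x + e * I) = 0 := by
  have hI : Integrable (fun x : ℝ => auxF (x + e * I)) := auxF_int he.le he1
  have h1 := intervalIntegral_tendsto_integral hI tendsto_neg_atTop_atBot tendsto_id
  refine tendsto_nhds_unique h1 ?_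
  obtain ⟨C, hC, hb⟩ := auxG_far
  have hlim : Tendsto (fun R : ℝ => 4 * C / √R) atTop (𝓝 0) :=
    tendsto_const_nhds.div_atTop Real.tendsto_sqrt_atTop
  refine squeeze_zero_norm' ?_ hlim
  filter_upwards [eventually_ge_atTop 4] with R hR
  have hF : ∫ x in (-R)..(id R), auxF (x + e * I) = ∫ x in (-R)..R, auxG (x + e * I) := by
    apply intervalIntegral.integral_congr
    intro x _
    refine (auxG_eq ?_).symm
    intro h; have := congrArg Complex.im h; simp at this; linarith
  have key := Complex.integral_boundary_rect_eq_zero_of_differentiableOn auxG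
    (((-R : ℝ) : ℂ) + e * I) ((R : ℂ) + ((e + R : ℝ) : ℂ) * I) (auxG_diff.mono (by
      intro z hz
      have := hz.2
      simp only [mem_preimage] at this
      rw [uIcc_of_le (by simp; linarith)] at this
      have := this.1
      simp at this
      exact lt_of_lt_of_le he this))
  have r1 : (((-R : ℝ) : ℂ) + e * I).re = -R := by simp
  have r2 : (((-R : ℝ) : ℂ) + e * I).im = e := by simp
  have r3 : ((R : ℂ) + ((e + R : ℝ) : ℂ) * I).re = R := by simp
  have r4 : ((R : ℂ) + ((e + R : ℝ) : ℂ) * I).im = e + R := by simp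
  rw [r1, r2, r3, r4] at key
  have hRp : 0 < R := by linarith
  have t1 : ‖∫ x : ℝ in (-R)..R, auxG (x + ((e + R : ℝ) : ℂ) * I)‖ ≤ C / (R * √R) * |R - -R| := by
    apply intervalIntegral.norm_integral_le_of_norm_le_const
    intro x _
    refine hb R hR _ (by simp; linarith) ?_
    refine le_trans ?_ (Complex.abs_im_le_norm _)
    simp
    exact le_trans (by linarith) (le_abs_self _)
  have t2 : ‖∫ y : ℝ in e..(e + R), auxG ((R : ℂ) + y * I)‖ ≤ C / (R * √R) * |e + R - e| := by
    apply intervalIntegral.norm_integral_le_of_norm_le_const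
    intro y hy
    rw [uIoc_of_le (by linarith)] at hy
    refine hb R hR _ (by simp; linarith [hy.1]) ?_
    refine le_trans ?_ (Complex.abs_re_le_norm _)
    simp
    exact le_abs_self _
  have t3 : ‖∫ y : ℝ in e..(e + R), auxG (((-R : ℝ) : ℂ) + y * I)‖ ≤
      C / (R * √R) * |e + R - e| := by
    apply intervalIntegral.norm_integral_le_of_norm_le_const
    intro y hy
    rw [uIoc_of_le (by linarith)] at hy
    refine hb R hR _ (by simp; linarith [hy.1]) ?_
    refine le_trans ?_ (Complex.abs_re_le_norm _)
    simp
    exact le_abs_self _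
  rw [show R - -R = 2 * R by ring, abs_of_pos (by linarith)] at t1
  rw [show e + R - e = R by ring, abs_of_pos hRp] at t2 t3
  rw [hF]
  set A := ∫ x : ℝ in (-R)..R, auxG (x + e * I)
  set A1 := ∫ x : ℝ in (-R)..R, auxG (x + ((e + R : ℝ) : ℂ) * I)
  set A2 := ∫ y : ℝ in e..(e + R), auxG ((R : ℂ) + y * I)
  set A3 := ∫ y : ℝ in e..(e + R), auxG (((-R : ℝ) : ℂ) + y * I)
  have hA : A = A1 - I * A2 + I * A3 := by
    simp only [smul_eq_mul] at key
    linear_combination key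
  have n2 : ‖I * A2‖ = ‖A2‖ := by simp
  have n3 : ‖I * A3‖ = ‖A3‖ := by simp
  have hn : ‖A‖ ≤ ‖A1‖ + ‖A2‖ + ‖A3‖ := by
    rw [hA, ← n2, ← n3]
    exact (norm_add_le _ _).trans (by gcongr; exact norm_sub_le _ _)
  have hq : 4 * C / √R = C / (R * √R) * (2 * R) + C / (R * √R) * R + C / (R * √R) * R := by
    have : √R ≠ 0 := (Real.sqrt_pos.2 hRp).ne'
    field_simp; ring
  linarith

lemma aux_integral_F : ∫ x : ℝ, auxF x = 0 := by
  refine tendsto_nhds_unique auxF_tendsto ?_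
  refine tendsto_const_nhds.congr' ?_
  filter_upwards [Ioo_mem_nhdsGT (zero_lt_one (α := ℝ))] with e he
  exact (auxG_zero he.1 he.2.le).symm

theorem example_five :
    ∫ y : ℝ, (y : ℂ) * Complex.log (Complex.log y) /
        ((1 - I * y) * ((y : ℂ) ^ 2 + 4)) =
      (1 / 3) * I * (π : ℂ) * Complex.log (Complex.log 2 + I * π / 2) := by
  have h1 : ∀ y : ℝ, (y : ℂ) * Complex.log (Complex.log y) /
        ((1 - I * y) * ((y : ℂ) ^ 2 + 4)) = auxF y + auxK y * auxL (2 * I) := by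
    intro y
    rw [auxF, auxK, auxL]
    ring
  have hI : Integrable (fun x : ℝ => auxF x) := by
    simpa using auxF_int (e := 0) le_rfl zero_le_one
  have h2 : auxL (2 * I) = Complex.log (Complex.log 2 + I * π / 2) := by
    rw [auxL]
    congr 1
    have := Complex.log_ofReal_mul (r := 2) (by norm_num) Complex.I_ne_zero
    push_cast at this
    rw [this, Complex.log_I, Complex.ofReal_log (by norm_num)]
    push_cast
    ring
  simp_rw [h1]
  rw [integral_add hI (aux_int_K.mul_const _), aux_integral_F, integral_mul_const,
    aux_integral_K, h2]
  ring
end
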